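/- arXiv:math/0311135 — 8 statements merged into one kernel-verified Lean document; each statement's English description precedes it below -/
import Mathlib

section
/- For every covering of the plane by countably many Borel sets, ℝ × ℝ = ⋃ₙ Aₙ with each Aₙ Borel, there exist an index n and nonempty perfect sets P, Q ⊆ ℝ such that P × Q ⊆ Aₙ. -/
open MeasureTheory Set Filter Topology

/-- A set of positive measure meets some arbitrarily small positive translate of itself, in any
prescribed direction, in a set of positive measure. -/
lemma exists_small_translate_inter_pos {E : Set (ℝ × ℝ)} (hE : MeasurableSet E)
    (hpos : 0 < volume E) (v : ℝ × ℝ) {ε : ℝ} (hε : 0 < ε) :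
    ∃ t ∈ Ioo 0 ε, 0 < volume (E ∩ (fun z => z + t • v) ⁻¹' E) := by
  by_contra! h
  have hdisj : ∀ s t : Ioo 0 ε, s < t →
      volume ((fun z => z + s.1 • v) ⁻¹' E ∩ (fun z => z + t.1 • v) ⁻¹' E) = 0 := by
    intro s t hst
    have hst' : s.1 < t.1 := hst
    have h0 := nonpos_iff_eq_zero.1
      (h (t.1 - s.1) ⟨by linarith, by linarith [s.2.1, t.2.2]⟩)
    rw [← measure_preimage_add_right volume (s.1 • v)] at h0
    convert h0 using 2
    ext z
    simp [add_assoc, ← add_smul]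
  have hcount := Measure.countable_meas_pos_of_disjoint_iUnion₀ (μ := (volume : Measure (ℝ × ℝ)))
    (As := fun t : Ioo 0 ε => (fun z : ℝ × ℝ => z + t.1 • v) ⁻¹' E)
    (fun t => (hE.preimage (measurable_add_const _)).nullMeasurableSet)
    (fun s t hst => by
      rcases lt_or_gt_of_ne hst with h1 | h1
      · exact hdisj s t h1
      · exact AEDisjoint.symm (hdisj t s h1))
  simp only [measure_preimage_add_right, hpos, ofPred_true, countable_univ_iff] at hcount
  have huncount := Cardinal.mk_Ioo_real hε
  exact (Cardinal.cantor Cardinal.aleph0).not_ge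
    (by rw [Cardinal.two_power_aleph0, ← huncount]; exact Cardinal.mk_le_aleph0_iff.2 hcount)

/-- The sums `x + ∑ i ∈ F, a i`, where `F` ranges over the subsets of `{0, …, n - 1}`. -/
def subsums (a : ℕ → ℝ) : ℕ → ℝ → Set ℝ
  | 0, x => {x}
  | n + 1, x => subsums a n x ∪ subsums a n (x + a n)

lemma subsums_mono (a : ℕ → ℝ) (x : ℝ) : Monotone fun n => subsums a n x :=
  monotone_nat_of_le_succ fun _ => subset_union_left

lemma add_mem_subsums {a : ℕ → ℝ} {n : ℕ} {x p : ℝ} (hp : p ∈ subsums a n x) (c : ℝ) :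
    p + c ∈ subsums a n (x + c) := by
  induction n generalizing x with
  | zero => simp_all [subsums]
  | succ n ih =>
    rcases hp with hp | hp
    · exact .inl (ih hp)
    · exact .inr (by simpa [add_right_comm] using ih hp)

lemma preperfect_iUnion_subsums {a : ℕ → ℝ} (hpos : ∀ n, 0 < a n)
    (ha : Tendsto a atTop (𝓝 0)) (x : ℝ) : Preperfect (⋃ n, subsums a n x) := by
  rw [preperfect_iff_nhds]
  intro p hp U hU
  obtain ⟨n, hn⟩ := mem_iUnion.1 hp
  have hlim : Tendsto (fun m => p + a m) atTop (𝓝 p) := by simpa using ha.const_add p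
  obtain ⟨m, hmU, hnm⟩ := ((hlim.eventually hU).and (eventually_ge_atTop n)).exists
  exact ⟨p + a m, ⟨hmU, mem_iUnion.2 ⟨m + 1, .inr
    (add_mem_subsums (subsums_mono a x hnm hn) _)⟩⟩, by linarith [hpos m]⟩

/-- A compact subset of the plane of positive measure contains a product of two nonempty
perfect sets. -/
theorem IsCompact.exists_perfect_prod_subset {K : Set (ℝ × ℝ)} (hK : IsCompact K)
    (hpos : 0 < volume K) :
    ∃ P Q : Set ℝ, Perfect P ∧ P.Nonempty ∧ Perfect Q ∧ Q.Nonempty ∧ P ×ˢ Q ⊆ K := by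
  have step : ∀ (n : ℕ) (E : {E : Set (ℝ × ℝ) // IsCompact E ∧ 0 < volume E}),
      ∃ (F : {E : Set (ℝ × ℝ) // IsCompact E ∧ 0 < volume E}) (s t : ℝ),
        s ∈ Ioo 0 (1 / ((n : ℝ) + 1)) ∧ t ∈ Ioo 0 (1 / ((n : ℝ) + 1)) ∧
        ∀ z ∈ F.1, z ∈ E.1 ∧ (z.1 + s, z.2) ∈ E.1 ∧ (z.1, z.2 + t) ∈ E.1 ∧
          (z.1 + s, z.2 + t) ∈ E.1 := by
    rintro n ⟨E, hE, hEpos⟩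
    have hn : (0 : ℝ) < 1 / ((n : ℝ) + 1) := Nat.one_div_pos_of_nat
    obtain ⟨s, hs, hspos⟩ := exists_small_translate_inter_pos hE.measurableSet hEpos (1, 0) hn
    have hcs : IsCompact (E ∩ (fun z => z + s • ((1, 0) : ℝ × ℝ)) ⁻¹' E) :=
      hE.inter_right (hE.isClosed.preimage (continuous_add_const _))
    obtain ⟨t, ht, htpos⟩ := exists_small_translate_inter_pos hcs.measurableSet hspos (0, 1) hn
    refine ⟨⟨_, hcs.inter_right (hcs.isClosed.preimage (continuous_add_const _)), htpos⟩,
      s, t, hs, ht, ?_⟩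
    rintro ⟨x, y⟩ ⟨⟨h1, h2⟩, h3, h4⟩
    simp_all
  choose F s t hs ht hF using step
  let E : ℕ → {E : Set (ℝ × ℝ) // IsCompact E ∧ 0 < volume E} :=
    fun n => Nat.rec ⟨K, hK, hpos⟩ F n
  let a : ℕ → ℝ := fun n => s n (E n)
  let b : ℕ → ℝ := fun n => t n (E n)
  have hE : ∀ n, ∀ z ∈ (E (n + 1)).1, z ∈ (E n).1 ∧ (z.1 + a n, z.2) ∈ (E n).1 ∧
      (z.1, z.2 + b n) ∈ (E n).1 ∧ (z.1 + a n, z.2 + b n) ∈ (E n).1 := fun n => hF n (E n)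
  have ha : Tendsto a atTop (𝓝 0) := squeeze_zero (fun n => (hs n (E n)).1.le)
    (fun n => (hs n (E n)).2.le) tendsto_one_div_add_atTop_nhds_zero_nat
  have hb : Tendsto b atTop (𝓝 0) := squeeze_zero (fun n => (ht n (E n)).1.le)
    (fun n => (ht n (E n)).2.le) tendsto_one_div_add_atTop_nhds_zero_nat
  have hsub : ∀ n, ∀ z ∈ (E n).1, subsums a n z.1 ×ˢ subsums b n z.2 ⊆ K := by
    intro n
    induction n with
    | zero =>
      rintro z hz ⟨p, q⟩ ⟨rfl, rfl⟩
      exact hz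
    | succ n ih =>
      rintro z hz ⟨p, q⟩ ⟨hp, hq⟩
      obtain ⟨h1, h2, h3, h4⟩ := hE n z hz
      rcases hp with hp | hp <;> rcases hq with hq | hq
      · exact ih _ h1 ⟨hp, hq⟩
      · exact ih _ h3 ⟨hp, hq⟩
      · exact ih _ h2 ⟨hp, hq⟩
      · exact ih _ h4 ⟨hp, hq⟩
  obtain ⟨z, hz⟩ := IsCompact.nonempty_iInter_of_sequence_nonempty_isCompact_isClosed
    (fun n => (E n).1) (fun n z hz => (hE n z hz).1)
    (fun n => nonempty_of_measure_ne_zero (E n).2.2.ne') (E 0).2.1 (fun n => (E n).2.1.isClosed)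
  refine ⟨closure (⋃ n, subsums a n z.1), closure (⋃ n, subsums b n z.2),
    (preperfect_iUnion_subsums (fun n => (hs n (E n)).1) ha _).perfect_closure,
    ⟨z.1, subset_closure (mem_iUnion.2 ⟨0, rfl⟩)⟩,
    (preperfect_iUnion_subsums (fun n => (ht n (E n)).1) hb _).perfect_closure,
    ⟨z.2, subset_closure (mem_iUnion.2 ⟨0, rfl⟩)⟩, ?_⟩
  rw [← closure_prod_eq]
  refine closure_minimal ?_ hK.isClosed
  rintro ⟨p, q⟩ ⟨hp, hq⟩
  obtain ⟨m, hm⟩ := mem_iUnion.1 hp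
  obtain ⟨n, hn⟩ := mem_iUnion.1 hq
  exact hsub (max m n) z (mem_iInter.1 hz _) ⟨subsums_mono a _ (le_max_left m n) hm,
    subsums_mono b _ (le_max_right m n) hn⟩

/-- For every covering of the plane by countably many Borel sets,
`ℝ × ℝ = ⋃ₙ Aₙ` with each `Aₙ` Borel, there exist an index `n` and nonempty
perfect sets `P, Q ⊆ ℝ` such that `P × Q ⊆ Aₙ`. -/
theorem borel_cover_plane_perfect_rectangle
    (A : ℕ → Set (ℝ × ℝ)) (hA : ∀ n, MeasurableSet (A n))
    (hcov : (⋃ n, A n) = Set.univ) :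
    ∃ (n : ℕ) (P Q : Set ℝ), Perfect P ∧ P.Nonempty ∧ Perfect Q ∧ Q.Nonempty ∧
      P ×ˢ Q ⊆ A n := by
  obtain ⟨n, hn⟩ : ∃ n, 0 < volume (A n) := by
    apply exists_measure_pos_of_not_measure_iUnion_null
    rw [hcov]
    exact (isOpen_univ.measure_pos volume univ_nonempty).ne'
  obtain ⟨K, hKA, hK, hKpos⟩ := (hA n).exists_lt_isCompact hn
  obtain ⟨P, Q, hP, hP', hQ, hQ', hPQ⟩ := hK.exists_perfect_prod_subset hKpos
  exact ⟨n, P, Q, hP, hP', hQ, hQ', hPQ.trans hKA⟩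
end

section
/- Let (Bᵢ)ᵢ∈ℕ be uncountable Borel subsets of 2^ω and let (Cₙ)ₙ∈ℕ be Borel subsets of the product space (2^ω)^ℕ such that {x : ℕ → 2^ω | ∀ i, x i ∈ Bᵢ} ⊆ ⋃ₙ Cₙ. Then there exist an index n and nonempty perfect sets Pᵢ ⊆ Bᵢ (for every i ∈ ℕ) such that {x : ℕ → 2^ω | ∀ i, x i ∈ Pᵢ} ⊆ Cₙ. -/
open Set Filter Topology

/-- The basic open set of all sequences agreeing with `y` on the square `L × L`. -/
def squareCylinder (y : ℕ → ℕ → Bool) (L : ℕ) : Set (ℕ → ℕ → Bool) :=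
  {z | ∀ i < L, ∀ j < L, z i j = y i j}

theorem isOpen_squareCylinder (y : ℕ → ℕ → Bool) (L : ℕ) : IsOpen (squareCylinder y L) := by
  have h : squareCylinder y L = ⋂ i ∈ Iio L, ⋂ j ∈ Iio L, {z | z i j = y i j} := by
    ext z; simp [squareCylinder]
  rw [h]
  refine (finite_Iio L).isOpen_biInter fun i _ => (finite_Iio L).isOpen_biInter fun j _ => ?_
  exact (isOpen_discrete {y i j}).preimage (by fun_prop : Continuous fun z : ℕ → ℕ → Bool => z i j)

theorem exists_squareCylinder_subset {U : Set (ℕ → ℕ → Bool)} (hU : IsOpen U)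
    {y : ℕ → ℕ → Bool} (hy : y ∈ U) (M : ℕ) : ∃ L, M ≤ L ∧ squareCylinder y L ⊆ U := by
  by_contra! h
  have h' : ∀ k, ∃ z ∈ squareCylinder y (M + k), z ∉ U := fun k =>
    not_subset.1 (h (M + k) (Nat.le_add_right _ _))
  choose z hz hzU using h'
  have hlim : Tendsto z atTop (𝓝 y) := by
    rw [tendsto_pi_nhds]
    intro i
    rw [tendsto_pi_nhds]
    intro j
    refine tendsto_const_nhds.congr' ?_
    filter_upwards [eventually_gt_atTop i, eventually_gt_atTop j] with k hi hj
    exact (hz k i (by omega) j (by omega)).symm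
  obtain ⟨k, hk⟩ := (hlim.eventually (hU.mem_nhds hy)).exists
  exact hzU k hk

/-- A finite stage of the fusion: a family of maps of the Cantor space, of which only the entries
in the square `depth × depth` are binding for later stages. -/
structure FusionStage where
  /-- The current approximations of the coordinate maps. -/
  toFun : ℕ → (ℕ → Bool) → ℕ → Bool
  /-- The side of the square of binding entries. -/
  depth : ℕ

namespace FusionStage

/-- `t` keeps the binding entries of `s`. -/
def Extends (s t : FusionStage) : Prop :=
  s.depth ≤ t.depth ∧ ∀ i < s.depth, ∀ j < s.depth, ∀ x, t.toFun i x j = s.toFun i x j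

/-- The `i`-th map of `s` depends only on the first `n - i` bits of its argument. -/
def DependsOnTriangle (n : ℕ) (s : FusionStage) : Prop :=
  ∀ i x x', (∀ j, i + j < n → x j = x' j) → s.toFun i x = s.toFun i x'

/-- The basic open set determined by `s` at a tuple of arguments. -/
def box (s : FusionStage) (x : ℕ → ℕ → Bool) : Set (ℕ → ℕ → Bool) :=
  squareCylinder (fun i => s.toFun i (x i)) s.depth

theorem Extends.refl (s : FusionStage) : s.Extends s := ⟨le_rfl, fun _ _ _ _ _ => rfl⟩

theorem Extends.trans {s t u : FusionStage} (h : s.Extends t) (h' : t.Extends u) :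
    s.Extends u :=
  ⟨h.1.trans h'.1, fun i hi j hj x =>
    (h'.2 i (hi.trans_le h.1) j (hj.trans_le h.1) x).trans (h.2 i hi j hj x)⟩

theorem Extends.box_subset {s t : FusionStage} (h : s.Extends t) (x : ℕ → ℕ → Bool) :
    t.box x ⊆ s.box x := fun _ hz i hi j hj =>
  (hz i (hi.trans_le h.1) j (hj.trans_le h.1)).trans (h.2 i hi j hj (x i))

theorem DependsOnTriangle.exists_extends_box_subset {n : ℕ} {s : FusionStage}
    (hs : s.DependsOnTriangle n) {D : Set (ℕ → ℕ → Bool)} (hDo : IsOpen D) (hDd : Dense D)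
    (x : ℕ → ℕ → Bool) :
    ∃ t : FusionStage, s.Extends t ∧ t.DependsOnTriangle n ∧ t.box x ⊆ D := by
  classical
  obtain ⟨y, hy, hyD⟩ := hDd.inter_open_nonempty (s.box x) (isOpen_squareCylinder _ _)
    ⟨fun i => s.toFun i (x i), fun _ _ _ _ => rfl⟩
  obtain ⟨L, hL, hLD⟩ := exists_squareCylinder_subset hDo hyD s.depth
  refine ⟨⟨fun i z => if ∀ j, i + j < n → z j = x i j then y i else s.toFun i z, L⟩,
    ⟨hL, fun i hi j hj z => ?_⟩, fun i z z' hz => ?_, ?_⟩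
  · dsimp only
    split_ifs with h
    · rw [hs i z (x i) h]
      exact hy i hi j hj
    · rfl
  · have : (∀ j, i + j < n → z j = x i j) ↔ ∀ j, i + j < n → z' j = x i j :=
      forall₂_congr fun j hj => by rw [hz j hj]
    simp only [this, hs i z z' hz]
  · simpa [box] using hLD

theorem DependsOnTriangle.exists_extends_forall_mem {n : ℕ} {s : FusionStage}
    (hs : s.DependsOnTriangle n) {D : Set (ℕ → ℕ → Bool)} (hDo : IsOpen D) (hDd : Dense D)
    (F : Finset (ℕ → ℕ → Bool)) :
    ∃ t : FusionStage, s.Extends t ∧ t.DependsOnTriangle n ∧ ∀ x ∈ F, t.box x ⊆ D := by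
  classical
  induction F using Finset.induction_on with
  | empty => exact ⟨s, .refl s, hs, by simp⟩
  | insert x F _ ih =>
    obtain ⟨t, hst, ht, hF⟩ := ih
    obtain ⟨u, htu, hu, hx⟩ := ht.exists_extends_box_subset hDo hDd x
    refine ⟨u, hst.trans htu, hu, fun z hz => ?_⟩
    rcases Finset.mem_insert.1 hz with rfl | hz
    · exact hx
    · exact (htu.box_subset z).trans (hF z hz)

theorem DependsOnTriangle.exists_extends_forall {n : ℕ} {s : FusionStage}
    (hs : s.DependsOnTriangle n) {D : Set (ℕ → ℕ → Bool)} (hDo : IsOpen D) (hDd : Dense D) :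
    ∃ t : FusionStage, s.Extends t ∧ t.DependsOnTriangle n ∧ ∀ x, t.box x ⊆ D := by
  classical
  let extend (τ : Fin n → Fin n → Bool) : ℕ → ℕ → Bool := fun i j =>
    if h : i < n ∧ j < n then τ ⟨i, h.1⟩ ⟨j, h.2⟩ else false
  obtain ⟨t, hst, ht, hF⟩ := hs.exists_extends_forall_mem hDo hDd (Finset.univ.image extend)
  refine ⟨t, hst, ht, fun x => ?_⟩
  have key : t.box x = t.box (extend fun i j => x i j) := by
    unfold box
    congr 1
    funext i
    refine ht i _ _ fun j hj => ?_
    have : i < n ∧ j < n := by omega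
    simp [extend, this]
  rw [key]
  exact hF _ (Finset.mem_image_of_mem _ (Finset.mem_univ _))

theorem DependsOnTriangle.exists_extends_split {n : ℕ} {s : FusionStage}
    (hs : s.DependsOnTriangle n) (hn : n ≤ s.depth) :
    ∃ t : FusionStage, s.Extends t ∧ t.DependsOnTriangle (n + 1) ∧ n + 1 ≤ t.depth ∧
      ∀ i ≤ n, ∃ l < t.depth, ∀ x, t.toFun i x l = x (n - i) := by
  classical
  refine ⟨⟨fun i x => if i ≤ n then Function.update (s.toFun i x) s.depth (x (n - i))
      else s.toFun i x, s.depth + 1⟩, ⟨Nat.le_succ _, fun i hi j hj x => ?_⟩,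
    fun i x x' h => ?_, Nat.succ_le_succ hn, fun i hi => ⟨s.depth, Nat.lt_succ_self _, ?_⟩⟩
  · dsimp only
    split_ifs
    · exact Function.update_of_ne hj.ne _ _
    · rfl
  · have h₁ : s.toFun i x = s.toFun i x' := hs i x x' fun j hj => h j (by omega)
    dsimp only
    split_ifs with hi
    · rw [h₁, h (n - i) (by omega)]
    · exact h₁
  · simp [hi]

end FusionStage

open FusionStage in
/-- A relatively comeagre subset of a nonempty open subset of `(2^ω)^ℕ` contains a product of
copies of the Cantor space. -/
theorem exists_continuous_injective_forall_mem {U : Set (ℕ → ℕ → Bool)} (hUo : IsOpen U)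
    (hU : U.Nonempty) (D : ℕ → Set (ℕ → ℕ → Bool)) (hDo : ∀ n, IsOpen (D n))
    (hDd : ∀ n, Dense (D n)) :
    ∃ h : ℕ → (ℕ → Bool) → ℕ → Bool, (∀ i, Continuous (h i)) ∧ (∀ i, Function.Injective (h i)) ∧
      ∀ x : ℕ → ℕ → Bool, (fun i => h i (x i)) ∈ U ∩ ⋂ n, D n := by
  obtain ⟨y, hy⟩ := hU
  obtain ⟨L, -, hL⟩ := exists_squareCylinder_subset hUo hy 0
  have step : ∀ (n : ℕ) (s : FusionStage), ∃ t : FusionStage,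
      s.DependsOnTriangle n ∧ n ≤ s.depth → s.Extends t ∧ t.DependsOnTriangle (n + 1) ∧
        n + 1 ≤ t.depth ∧ (∀ i ≤ n, ∃ l < t.depth, ∀ x, t.toFun i x l = x (n - i)) ∧
        ∀ x, t.box x ⊆ D n := by
    intro n s
    by_cases hs : s.DependsOnTriangle n ∧ n ≤ s.depth
    · obtain ⟨t, hst, ht, htD⟩ := hs.1.exists_extends_forall (hDo n) (hDd n)
      obtain ⟨u, htu, hu, hnu, hsplit⟩ := ht.exists_extends_split (hs.2.trans hst.1)
      exact ⟨u, fun _ => ⟨hst.trans htu, hu, hnu, hsplit,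
        fun x => (htu.box_subset x).trans (htD x)⟩⟩
    · exact ⟨s, fun h => (hs h).elim⟩
  choose next hnext using step
  let S : ℕ → FusionStage := fun n => Nat.rec ⟨fun i _ => y i, L⟩ next n
  have hS : ∀ n, (S n).DependsOnTriangle n ∧ n ≤ (S n).depth := by
    intro n
    induction n with
    | zero => exact ⟨fun _ _ _ _ => rfl, Nat.zero_le _⟩
    | succ n ih => exact ⟨(hnext n _ ih).2.1, (hnext n _ ih).2.2.1⟩
  have hmono : ∀ m n, m ≤ n → (S m).Extends (S n) := by
    intro m n hmn
    induction n, hmn using Nat.le_induction with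
    | base => exact .refl _
    | succ n _ ih => exact ih.trans (hnext n _ (hS n)).1
  let h : ℕ → (ℕ → Bool) → ℕ → Bool := fun i x j => (S (max i j + 1)).toFun i x j
  have hlim : ∀ n i j x, i < (S n).depth → j < (S n).depth → h i x j = (S n).toFun i x j := by
    intro n i j x hi hj
    have hd := (hS (max i j + 1)).2
    rcases le_total n (max i j + 1) with hle | hle
    · exact (hmono _ _ hle).2 i hi j hj x
    · exact ((hmono _ _ hle).2 i (by omega) j (by omega) x).symm
  have hbox : ∀ n x, (fun i => h i (x i)) ∈ (S n).box x := fun n x i hi j hj =>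
    hlim n i j (x i) hi hj
  refine ⟨h, fun i => continuous_pi fun j => ?_, fun i x x' hxx => funext fun k => ?_,
    fun x => ⟨hL (hbox 0 x), mem_iInter.2 fun n => (hnext n _ (hS n)).2.2.2.2 x (hbox (n + 1) x)⟩⟩
  · let N := max i j + 1
    let φ : (Fin N → Bool) → Bool := fun a =>
      h i (fun k => if hk : k < N then a ⟨k, hk⟩ else false) j
    have hφ : (fun x => h i x j) = φ ∘ fun x (k : Fin N) => x k := by
      funext x
      refine congrFun ((hS N).1 i _ _ fun k hk => ?_) j
      have : k < N := by omega
      simp [this]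
    rw [hφ]
    exact continuous_of_discreteTopology.comp (by fun_prop)
  · obtain ⟨l, hl, hsplit⟩ := (hnext (i + k) _ (hS (i + k))).2.2.2.1 i (Nat.le_add_right _ _)
    have hi : i < (S (i + k + 1)).depth := by have := (hS (i + k + 1)).2; omega
    have hbit : ∀ z, h i z l = z k := fun z => by
      rw [hlim (i + k + 1) i l z hi hl]
      exact (hsplit z).trans (by rw [Nat.add_sub_cancel_left])
    rw [← hbit x, ← hbit x', hxx]

theorem perfect_range_of_continuous_injective {X Y : Type*} [TopologicalSpace X]
    [TopologicalSpace Y] [CompactSpace X] [PerfectSpace X] [T2Space Y] {f : X → Y}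
    (hf : Continuous f) (hinj : Function.Injective f) : Perfect (range f) := by
  refine ⟨(isCompact_range hf).isClosed, ?_⟩
  rintro _ ⟨x, rfl⟩
  rw [accPt_iff_nhds]
  intro V hV
  have hx : AccPt x (𝓟 univ) := PerfectSpace.univ_preperfect x (mem_univ x)
  obtain ⟨z, ⟨hz, -⟩, hne⟩ := accPt_iff_nhds.1 hx _ (hf.continuousAt hV)
  exact ⟨f z, ⟨hz, mem_range_self z⟩, hinj.ne hne⟩

instance perfectSpace_cantor : PerfectSpace (ℕ → Bool) := by
  refine ⟨fun x _ => accPt_iff_nhds.2 fun V hV => ?_⟩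
  have hlim : Tendsto (fun n => Function.update x n (!x n)) atTop (𝓝 x) := by
    rw [tendsto_pi_nhds]
    intro j
    refine tendsto_const_nhds.congr' ?_
    filter_upwards [eventually_gt_atTop j] with k hk
    exact (Function.update_of_ne hk.ne _ _).symm
  obtain ⟨n, hn⟩ := (hlim.eventually hV).exists
  exact ⟨_, ⟨hn, mem_univ _⟩, fun h => by simpa using congrFun h n⟩

/-- The perfect set theorem for Borel sets. -/
theorem MeasurableSet.exists_nat_bool_injection_of_not_countable {X : Type*}
    [TopologicalSpace X] [PolishSpace X] [MeasurableSpace X] [BorelSpace X] {s : Set X}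
    (hs : MeasurableSet s) (hunc : ¬ s.Countable) :
    ∃ f : (ℕ → Bool) → X, range f ⊆ s ∧ Continuous f ∧ Function.Injective f := by
  obtain ⟨τ, hle, hτ, hclosed, -⟩ := hs.isClopenable
  obtain ⟨f, hfs, hf, hinj⟩ :=
    @IsClosed.exists_nat_bool_injection_of_not_countable X τ hτ s hclosed hunc
  exact ⟨f, hfs, continuous_le_rng hle hf, hinj⟩

theorem exists_isOpen_nonempty_residual_of_iUnion_eq_univ {X : Type*} [TopologicalSpace X]
    [BaireSpace X] [Nonempty X] [MeasurableSpace X] [BorelSpace X] {C : ℕ → Set X}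
    (hC : ∀ n, MeasurableSet (C n)) (hcov : ⋃ n, C n = univ) :
    ∃ n, ∃ U : Set X, IsOpen U ∧ U.Nonempty ∧ {x | x ∈ U → x ∈ C n} ∈ residual X := by
  choose U hUo hU using fun n => (hC n).residualEq_isOpen
  by_cases hne : ∃ n, (U n).Nonempty
  · obtain ⟨n, hn⟩ := hne
    refine ⟨n, U n, hUo n, hn, ?_⟩
    filter_upwards [eventuallyEq_set.1 (hU n)] with x hx using hx.2
  · have hall : ∀ᶠ x in residual X, ∀ n, x ∈ C n ↔ x ∈ U n :=
      eventually_countable_forall.2 fun n => eventuallyEq_set.1 (hU n)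
    obtain ⟨x, hx⟩ := (dense_of_mem_residual hall).nonempty
    obtain ⟨n, hn⟩ := mem_iUnion.1 (hcov ▸ mem_univ x)
    exact (hne ⟨n, x, (hx n).1 hn⟩).elim

theorem exists_seq_isOpen_dense_of_mem_residual {X : Type*} [TopologicalSpace X] {s : Set X}
    (hs : s ∈ residual X) :
    ∃ D : ℕ → Set X, (∀ n, IsOpen (D n)) ∧ (∀ n, Dense (D n)) ∧ ⋂ n, D n ⊆ s := by
  obtain ⟨S, hSo, hSd, hSc, hSs⟩ := mem_residual_iff.1 hs
  obtain ⟨D, hD⟩ := (hSc.insert univ).exists_eq_range (insert_nonempty _ _)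
  have hmem : ∀ n, D n = univ ∨ D n ∈ S := fun n => mem_insert_iff.1 (hD ▸ mem_range_self n)
  refine ⟨D, fun n => ?_, fun n => ?_, ?_⟩
  · rcases hmem n with h | h
    · exact h ▸ isOpen_univ
    · exact hSo _ h
  · rcases hmem n with h | h
    · exact h ▸ dense_univ
    · exact hSd _ h
  · rw [← sInter_range, ← hD]
    exact (sInter_subset_sInter (subset_insert _ _)).trans hSs


/-- Countable-dimensional rectangular Ramsey property for the ideal of
countable sets on Cantor space: if a countable product of uncountable Borel
sets is covered by countably many Borel subsets of `(2^ω)^ℕ`, then one piece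
of the cover contains a product of nonempty perfect sets. -/
theorem mrr_countable_ideal_product
    (B : ℕ → Set (ℕ → Bool))
    (hBmeas : ∀ i, MeasurableSet (B i))
    (hBunc : ∀ i, ¬ (B i).Countable)
    (C : ℕ → Set (ℕ → (ℕ → Bool)))
    (hCmeas : ∀ n, MeasurableSet (C n))
    (hcov : {x : ℕ → (ℕ → Bool) | ∀ i, x i ∈ B i} ⊆ ⋃ n, C n) :
    ∃ (n : ℕ) (P : ℕ → Set (ℕ → Bool)),
      (∀ i, Perfect (P i)) ∧ (∀ i, (P i).Nonempty) ∧ (∀ i, P i ⊆ B i) ∧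
      {x : ℕ → (ℕ → Bool) | ∀ i, x i ∈ P i} ⊆ C n := by
  have : PolishSpace Bool := { }
  choose f hfB hf hfinj using fun i => (hBmeas i).exists_nat_bool_injection_of_not_countable (hBunc i)
  let g : (ℕ → ℕ → Bool) → ℕ → ℕ → Bool := fun x i => f i (x i)
  have hg : Continuous g := continuous_pi fun i => (hf i).comp (continuous_apply i)
  have hcov' : ⋃ n, g ⁻¹' C n = univ := eq_univ_of_forall fun x => by
    rw [← preimage_iUnion]
    exact hcov fun i => hfB i (mem_range_self _)
  obtain ⟨n, U, hUo, hU, hres⟩ := exists_isOpen_nonempty_residual_of_iUnion_eq_univ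
    (fun n => hg.measurable (hCmeas n)) hcov'
  obtain ⟨D, hDo, hDd, hD⟩ := exists_seq_isOpen_dense_of_mem_residual hres
  obtain ⟨h, hcont, hinj, hmem⟩ := exists_continuous_injective_forall_mem hUo hU D hDo hDd
  refine ⟨n, fun i => range (f i ∘ h i), fun i => perfect_range_of_continuous_injective
    ((hf i).comp (hcont i)) ((hfinj i).comp (hinj i)), fun i => range_nonempty _,
    fun i => (range_comp_subset_range _ _).trans (hfB i), fun x hx => ?_⟩
  choose y hy using hx
  have hxy : g (fun i => h i (y i)) = x := funext hy
  rw [← hxy]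
  exact hD (hmem y).2 (hmem y).1
end

section
/- For all Borel sets A, B ⊆ ℝ of positive Lebesgue measure there exist a ∈ A and b ∈ B with a + b rational, and there exist a' ∈ A and b' ∈ B with a' + b' irrational. Consequently the Borel set D = {(x,y) ∈ ℝ² : x + y ∈ ℚ} meets every Borel rectangle with Lebesgue-positive sides as well as its complement, so the rectangular Ramsey property MRR(null, null) fails. -/
open MeasureTheory

/-- Two measurable sets of reals of positive measure intersect in positive measure after a suitable
translation of one of them. -/
lemma exists_measure_preimage_add_inter_pos {A B : Set ℝ} (hA : MeasurableSet A)
    (hB : MeasurableSet B) (hA0 : 0 < volume A) (hB0 : 0 < volume B) :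
    ∃ x : ℝ, 0 < volume ((fun y => x + y) ⁻¹' A ∩ B) := by
  by_contra! h
  have hmp := measurePreserving_add_prod (volume : Measure ℝ) (volume : Measure ℝ)
  have hnull : (volume.prod volume) ((fun z : ℝ × ℝ => (z.1 + z.2, z.2)) ⁻¹' (A ×ˢ B)) = 0 := by
    rw [Measure.measure_prod_null (hmp.measurable (hA.prod hB))]
    exact Filter.Eventually.of_forall fun x => le_antisymm (h x) zero_le
  rw [hmp.measure_preimage (hA.prod hB).nullMeasurableSet, Measure.prod_prod] at hnull
  exact mul_ne_zero hA0.ne' hB0.ne' hnull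

open scoped Pointwise in
/-- Two measurable sets of reals of positive measure contain elements with rational sum. -/
lemma exists_add_eq_rat {A B : Set ℝ} (hA : MeasurableSet A) (hB : MeasurableSet B)
    (hA0 : 0 < volume A) (hB0 : 0 < volume B) :
    ∃ a ∈ A, ∃ b ∈ B, ∃ q : ℚ, a + b = (q : ℝ) := by
  obtain ⟨x, hx⟩ := exists_measure_preimage_add_inter_pos hA hB.neg hA0
    (by rwa [Measure.measure_neg])
  have hnhds := Measure.sub_mem_nhds_zero_of_addHaar_pos volume _
    ((hA.preimage (measurable_const_add x)).inter hB.neg) hx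
  have hx_nhds : (fun t : ℝ => t - x) ⁻¹' (((fun y => x + y) ⁻¹' A ∩ -B) -
      ((fun y => x + y) ⁻¹' A ∩ -B)) ∈ nhds x :=
    (continuous_sub_right x).continuousAt.preimage_mem_nhds (by rwa [sub_self])
  obtain ⟨q, c, hc, c', hc', hq⟩ := Rat.denseRange_cast.mem_nhds hx_nhds
  refine ⟨x + c, hc.1, -c', hc'.2, q, ?_⟩
  dsimp only at hq
  linarith

/-- A nonempty set and a set of positive measure contain elements with irrational sum. -/
lemma exists_irrational_add {A B : Set ℝ} (hA : A.Nonempty) (hB0 : 0 < volume B) :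
    ∃ a ∈ A, ∃ b ∈ B, Irrational (a + b) := by
  obtain ⟨a, ha⟩ := hA
  have hc : (Set.range fun q : ℚ => (q : ℝ) - a).Countable := Set.countable_range _
  obtain ⟨b, hb, hb'⟩ := ((frequently_ae_mem_iff.2 hB0.ne').and_eventually
    (hc.ae_notMem volume)).exists
  refine ⟨a, ha, b, hb, ?_⟩
  rintro ⟨q, hq⟩
  exact hb' ⟨q, by simp [hq]⟩

/-- For all Borel sets `A, B ⊆ ℝ` of positive Lebesgue measure there are
`a ∈ A`, `b ∈ B` with `a + b` rational, and `a' ∈ A`, `b' ∈ B` with `a' + b'`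
irrational.  Consequently the Borel set `D = {(x,y) | x + y ∈ ℚ}` meets every
Borel rectangle with Lebesgue-positive sides as well as its complement, so
`MRR(null, null)` fails. -/
theorem mrr_null_null_fails
    (D : Set (ℝ × ℝ)) (hD : D = {p : ℝ × ℝ | ∃ q : ℚ, p.1 + p.2 = (q : ℝ)}) :
    MeasurableSet D ∧
    ∀ (A B : Set ℝ), MeasurableSet A → MeasurableSet B →
      0 < volume A → 0 < volume B →
      ((∃ a ∈ A, ∃ b ∈ B, ∃ q : ℚ, a + b = (q : ℝ)) ∧
        (∃ a' ∈ A, ∃ b' ∈ B, Irrational (a' + b'))) ∧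
      ((A ×ˢ B ∩ D).Nonempty ∧ (A ×ˢ B \ D).Nonempty) := by
  subst hD
  refine ⟨?_, fun A B hA hB hA0 hB0 => ?_⟩
  · have hpre : {p : ℝ × ℝ | ∃ q : ℚ, p.1 + p.2 = (q : ℝ)} =
        (fun p : ℝ × ℝ => p.1 + p.2) ⁻¹' Set.range ((↑) : ℚ → ℝ) := by
      ext p
      simp [eq_comm]
    rw [hpre]
    exact (Set.countable_range _).measurableSet.preimage measurable_add
  · have hrat := exists_add_eq_rat hA hB hA0 hB0
    have hirr := exists_irrational_add (nonempty_of_measure_ne_zero hA0.ne') hB0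
    refine ⟨⟨hrat, hirr⟩, ?_, ?_⟩
    · obtain ⟨a, ha, b, hb, hq⟩ := hrat
      exact ⟨(a, b), ⟨ha, hb⟩, hq⟩
    · obtain ⟨a, ha, b, hb, hq⟩ := hirr
      exact ⟨(a, b), ⟨ha, hb⟩, fun ⟨q, h⟩ => hq ⟨q, h.symm⟩⟩
end

section
/- There exists a Borel function c : (ω^ω)³ → Bool such that for all superperfect trees T₀, T₁, T₂ on ℕ, the function c is not constant on the block [T₀] × [T₁] × [T₂]. In particular, the three-dimensional rectangular Ramsey property MRR(I, I, I) fails for the Miller ideal I. -/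
/-- A tree on `ℕ`: a set of finite sequences closed under initial segments. -/
def IsTreeOnNat (T : Set (List ℕ)) : Prop :=
  ∀ s ∈ T, ∀ t : List ℕ, t <+: s → t ∈ T

/-- The set of infinite branches of a tree on `ℕ`. -/
def branches (T : Set (List ℕ)) : Set (ℕ → ℕ) :=
  {x | ∀ n : ℕ, (List.ofFn fun i : Fin n => x i) ∈ T}

/-- A superperfect tree on `ℕ`: a nonempty tree in which every node has an
extension with infinitely many immediate successors in the tree. -/
def IsSuperperfectTree (T : Set (List ℕ)) : Prop :=
  IsTreeOnNat T ∧ T.Nonempty ∧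
    ∀ s ∈ T, ∃ t ∈ T, s <+: t ∧ {m : ℕ | t ++ [m] ∈ T}.Infinite

/-- The strictly increasing sequence of partial sums of `x + 1`. -/
def partialSums (x : ℕ → ℕ) (n : ℕ) : ℕ := ∑ j ∈ Finset.range (n + 1), (x j + 1)

/-- The total weight of a finite sequence, compatible with `partialSums`. -/
def listWeight (s : List ℕ) : ℕ := ∑ j ∈ Finset.range s.length, (s.getD j 0 + 1)

/-- `s` is an infinitely splitting node of `T`. -/
def IsSplittingNode (T : Set (List ℕ)) (s : List ℕ) : Prop :=
  s ∈ T ∧ {m : ℕ | s ++ [m] ∈ T}.Infinite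

/-- Infinitely often, an element of the range of `partialSums x` is immediately followed, among
the elements of the three ranges, by an element of the range of `partialSums y`. -/
def FollowsInfinitelyOften (x y z : ℕ → ℕ) : Prop :=
  ∀ N, ∃ a ≥ N, ∃ b > a, (∃ n, partialSums x n = a) ∧ (∃ n, partialSums y n = b) ∧
    ∀ v, a < v → v < b →
      (¬ ∃ n, partialSums x n = v) ∧ (¬ ∃ n, partialSums y n = v) ∧ ¬ ∃ n, partialSums z n = v

lemma partialSums_mono (x : ℕ → ℕ) : Monotone (partialSums x) := by
  intro m n h
  exact Finset.sum_le_sum_of_subset (Finset.range_mono (by omega))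

lemma le_partialSums (x : ℕ → ℕ) (n : ℕ) : x n ≤ partialSums x n := by
  have := Finset.single_le_sum (f := fun j => x j + 1) (s := Finset.range (n + 1))
    (fun _ _ => Nat.zero_le _) (Finset.self_mem_range_succ n)
  unfold partialSums
  omega

lemma partialSums_le_listWeight {x : ℕ → ℕ} {s : List ℕ} {n : ℕ}
    (hx : ∀ j < s.length, s.getD j 0 = x j) (hn : n < s.length) :
    partialSums x n ≤ listWeight s := by
  have h : listWeight s = ∑ j ∈ Finset.range s.length, (x j + 1) :=
    Finset.sum_congr rfl fun j hj => by rw [hx j (Finset.mem_range.mp hj)]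
  rw [h]
  exact Finset.sum_le_sum_of_subset (Finset.range_mono hn)

lemma IsSuperperfectTree.exists_isSplittingNode {T : Set (List ℕ)} (hT : IsSuperperfectTree T)
    {s : List ℕ} (hs : s ∈ T) : ∃ t, s <+: t ∧ IsSplittingNode T t := by
  obtain ⟨t, ht, hst, hinf⟩ := hT.2.2 s hs
  exact ⟨t, hst, ht, hinf⟩

lemma getD_eq_of_initial_segment {s t : List ℕ} (h : s <+: t) {n : ℕ} (hn : n < s.length) :
    t.getD n 0 = s.getD n 0 := by
  obtain ⟨u, rfl⟩ := h
  exact List.getD_append _ _ _ _ hn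

/-- A chain of finite sequences of unbounded length has a limit. -/
lemma exists_limit_of_isPrefix_chain {L : ℕ → List ℕ} (hL : ∀ k, L k <+: L (k + 1))
    (hlen : ∀ n, ∃ k, n < (L k).length) :
    ∃ x : ℕ → ℕ, ∀ k, ∀ n < (L k).length, (L k).getD n 0 = x n := by
  have hmono : ∀ {k l}, k ≤ l → L k <+: L l := by
    intro k l h
    induction l, h using Nat.le_induction with
    | base => exact List.prefix_rfl
    | succ l _ ih => exact ih.trans (hL l)
  choose K hK using hlen
  refine ⟨fun n => (L (K n)).getD n 0, fun k n hn => ?_⟩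
  rcases le_total k (K n) with h | h
  · exact (getD_eq_of_initial_segment (hmono h) hn).symm
  · exact getD_eq_of_initial_segment (hmono h) (hK n)

lemma mem_branches_of_getD {T : Set (List ℕ)} (hT : IsTreeOnNat T) {L : ℕ → List ℕ}
    (hLT : ∀ k, L k ∈ T) (hlen : ∀ n, ∃ k, n < (L k).length) {x : ℕ → ℕ}
    (hx : ∀ k, ∀ n < (L k).length, (L k).getD n 0 = x n) : x ∈ branches T := by
  intro n
  obtain ⟨k, hk⟩ := hlen n
  refine hT _ (hLT k) _ ?_
  have : (List.ofFn fun i : Fin n => x i) = (L k).take n := by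
    refine List.ext_getElem (by simp; omega) fun i h₁ h₂ => ?_
    have hi : i < (L k).length := by simp at h₂; omega
    have := hx k i hi
    rw [List.getD_eq_getElem _ _ hi] at this
    simp [this]
  rw [this]
  exact ⟨_, List.take_append_drop _ _⟩

/-- Three superperfect trees have branches whose partial sums lie in consecutive blocks, visited
cyclically. -/
lemma exists_branches_cyclic_blocks {T : Fin 3 → Set (List ℕ)}
    (hT : ∀ i, IsSuperperfectTree (T i)) :
    ∃ (x : Fin 3 → ℕ → ℕ) (b : ℕ → ℕ), (∀ i, x i ∈ branches (T i)) ∧ StrictMono b ∧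
      ∀ k i, (∃ n, b k ≤ partialSums (x i) n ∧ partialSums (x i) n < b (k + 1)) ↔
        i = Fin.ofNat 3 k := by
  let State := {p : (Fin 3 → List ℕ) × ℕ //
    ∀ i, IsSplittingNode (T i) (p.1 i) ∧ listWeight (p.1 i) < p.2}
  have hstep : ∀ (i : Fin 3) (p : State), ∃ q : State, (∀ j, j ≠ i → q.1.1 j = p.1.1 j) ∧
      (∃ m ≥ p.1.2, p.1.1 i ++ [m] <+: q.1.1 i) ∧ p.1.2 < q.1.2 := by
    rintro i ⟨⟨s, c⟩, hp⟩
    obtain ⟨m, hm, hcm⟩ := (hp i).1.2.exists_gt c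
    obtain ⟨t, hmt, ht⟩ := (hT i).exists_isSplittingNode hm
    refine ⟨⟨⟨Function.update s i t, max (c + 1) (listWeight t + 1)⟩, fun j => ?_⟩,
      fun j hj => ?_, ⟨m, hcm.le, ?_⟩, ?_⟩
    · by_cases hj : j = i
      · subst hj
        simpa using ht
      · simp only [Function.update_of_ne hj]
        have := hp j
        exact ⟨this.1, lt_of_lt_of_le this.2 (by simp; omega)⟩
    · simp [Function.update_of_ne hj]
    · simpa using hmt
    · simp
  have hinit : Nonempty State := by
    have h : ∀ i, ∃ t, IsSplittingNode (T i) t := fun i => by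
      obtain ⟨s, hs⟩ := (hT i).2.1
      obtain ⟨t, -, ht⟩ := (hT i).exists_isSplittingNode hs
      exact ⟨t, ht⟩
    choose t ht using h
    exact ⟨⟨⟨t, ∑ i, listWeight (t i) + 1⟩, fun i => ⟨ht i, Nat.lt_succ_of_le
      (Finset.single_le_sum (f := fun i => listWeight (t i)) (fun _ _ => Nat.zero_le _)
        (Finset.mem_univ i))⟩⟩⟩
  choose step hfix hmove hlt using hstep
  let st : ℕ → State := fun k => Nat.rec hinit.some (fun k p => step (Fin.ofNat 3 k) p) k
  let L : Fin 3 → ℕ → List ℕ := fun i k => (st k).1.1 i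
  let b : ℕ → ℕ := fun k => (st k).1.2
  have hb : StrictMono b := strictMono_nat_of_lt_succ fun k => hlt _ (st k)
  have hLfix : ∀ k i, i ≠ Fin.ofNat 3 k → L i (k + 1) = L i k := fun k i hi => hfix _ (st k) i hi
  have hLmove : ∀ k i, i = Fin.ofNat 3 k → ∃ m ≥ b k, L i k ++ [m] <+: L i (k + 1) := by
    rintro k i rfl
    exact hmove _ (st k)
  have hL : ∀ i k, L i k <+: L i (k + 1) := by
    intro i k
    by_cases hi : i = Fin.ofNat 3 k
    · obtain ⟨m, -, hm⟩ := hLmove k i hi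
      exact (List.prefix_append _ _).trans hm
    · rw [hLfix k i hi]
  have hLmono : ∀ i, Monotone fun k => (L i k).length :=
    fun i => monotone_nat_of_le_succ fun k => (hL i k).length_le
  have hLlt : ∀ k i, i = Fin.ofNat 3 k → (L i k).length < (L i (k + 1)).length := by
    intro k i hi
    obtain ⟨m, -, hm⟩ := hLmove k i hi
    simpa using hm.length_le
  have hturn : ∀ (i : Fin 3) (k : ℕ), ∃ d, i = Fin.ofNat 3 (k + d) := by
    intro i k
    refine ⟨i + 2 * k, Fin.ext ?_⟩
    simp only [Fin.ofNat]
    omega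
  have hlen : ∀ i n, ∃ k, n < (L i k).length := by
    intro i n
    induction n with
    | zero =>
      obtain ⟨d, hd⟩ := hturn i 0
      exact ⟨0 + d + 1, (Nat.zero_le _).trans_lt (hLlt _ i hd)⟩
    | succ n ih =>
      obtain ⟨k, hk⟩ := ih
      obtain ⟨d, hd⟩ := hturn i k
      have h₁ := hLlt _ i hd
      have h₂ : (L i k).length ≤ (L i (k + d)).length := hLmono i (Nat.le_add_right k d)
      exact ⟨k + d + 1, by omega⟩
  choose x hx using fun i => exists_limit_of_isPrefix_chain (hL i) (hlen i)
  have hbelow : ∀ i k n, n < (L i k).length → partialSums (x i) n < b k := fun i k n hn =>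
    lt_of_le_of_lt (partialSums_le_listWeight (hx i k) hn) ((st k).2 i).2
  have hnew : ∀ i d k, i = Fin.ofNat 3 (k + d) → b k ≤ x i (L i k).length := by
    intro i d
    have now : ∀ k, i = Fin.ofNat 3 k → b k ≤ x i (L i k).length := by
      intro k hi
      obtain ⟨m, hm, hpre⟩ := hLmove k i hi
      rw [← hx i (k + 1) _ (hLlt k i hi), getD_eq_of_initial_segment hpre (by simp)]
      simpa using hm
    induction d with
    | zero => exact now
    | succ d ih =>
      intro k hi
      by_cases hk : i = Fin.ofNat 3 k
      · exact now k hk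
      · have := ih (k + 1) (by rw [hi]; congr 1; omega)
        rw [hLfix k i hk] at this
        exact (hb (Nat.lt_succ_self k)).le.trans this
  have habove : ∀ i k n, (L i k).length ≤ n → b k ≤ partialSums (x i) n := by
    intro i k n hn
    obtain ⟨d, hd⟩ := hturn i k
    exact ((hnew i d k hd).trans (le_partialSums _ _)).trans (partialSums_mono _ hn)
  refine ⟨x, b, fun i => mem_branches_of_getD (hT i).1 (fun k => ((st k).2 i).1.1) (hlen i) (hx i),
    hb, fun k i => ⟨?_, fun hi => ?_⟩⟩
  · rintro ⟨n, h₁, h₂⟩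
    by_contra hi
    rcases lt_or_ge n (L i k).length with h | h
    · exact absurd (hbelow i k n h) (by omega)
    · rw [← hLfix k i hi] at h
      exact absurd (habove i (k + 1) n h) (by omega)
  · exact ⟨_, habove i k _ le_rfl, hbelow i (k + 1) _ (hLlt k i hi)⟩

lemma StrictMono.exists_block {b : ℕ → ℕ} (hb : StrictMono b) {v : ℕ} (hv : b 0 ≤ v) :
    ∃ k, b k ≤ v ∧ v < b (k + 1) := by
  have hex : ∃ k, v < b (k + 1) := ⟨v, lt_of_lt_of_le (Nat.lt_succ_self v) (hb.id_le _)⟩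
  refine ⟨Nat.find hex, ?_, Nat.find_spec hex⟩
  rcases h : Nat.find hex with _ | k
  · exact hv
  · exact not_lt.mp (Nat.find_min hex (m := k) (by omega))

section Blocks

variable {x : Fin 3 → ℕ → ℕ} {b : ℕ → ℕ}

lemma followsInfinitelyOften_of_blocks (hb : StrictMono b)
    (h : ∀ k i, (∃ n, b k ≤ partialSums (x i) n ∧ partialSums (x i) n < b (k + 1)) ↔
      i = Fin.ofNat 3 k) : FollowsInfinitelyOften (x 0) (x 1) (x 2) := by
  classical
  intro N
  have h0 : (0 : Fin 3) = Fin.ofNat 3 (3 * N) := Fin.ext (by simp [Fin.ofNat])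
  have h1 : (1 : Fin 3) = Fin.ofNat 3 (3 * N + 1) := Fin.ext (by simp [Fin.ofNat])
  have hmem : ∀ i v, b (3 * N) ≤ v → v < b (3 * N + 2) → (∃ n, partialSums (x i) n = v) →
      (v < b (3 * N + 1) ∧ i = 0) ∨ (b (3 * N + 1) ≤ v ∧ i = 1) := by
    rintro i v h₁ h₂ ⟨n, rfl⟩
    rcases lt_or_ge (partialSums (x i) n) (b (3 * N + 1)) with h' | h'
    · exact Or.inl ⟨h', by rw [h0]; exact (h (3 * N) i).1 ⟨n, h₁, h'⟩⟩
    · exact Or.inr ⟨h', by rw [h1]; exact (h (3 * N + 1) i).1 ⟨n, h', h₂⟩⟩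
  obtain ⟨n₀, hn₀, hn₀'⟩ := (h (3 * N) 0).2 h0
  have hex := (h (3 * N + 1) 1).2 h1
  obtain ⟨hm₀, hm₀'⟩ := Nat.find_spec hex
  set m := Nat.find hex
  -- the last element of the first block
  let A := (Finset.Ico (b (3 * N)) (b (3 * N + 1))).filter fun v => ∃ n, partialSums (x 0) n = v
  have hA : A.Nonempty := ⟨partialSums (x 0) n₀, by simp [A, hn₀, hn₀']⟩
  obtain ⟨a, ha, hmax⟩ := A.exists_max_image id hA
  simp only [A, Finset.mem_filter, Finset.mem_Ico, id] at ha hmax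
  have hN : N ≤ b (3 * N) := le_trans (by omega : N ≤ 3 * N) (hb.id_le (3 * N))
  refine ⟨a, hN.trans ha.1.1, partialSums (x 1) m, lt_of_lt_of_le ha.1.2 hm₀, ha.2, ⟨m, rfl⟩, ?_⟩
  have key : ∀ v, a < v → v < partialSums (x 1) m → ∀ i, ¬ ∃ n, partialSums (x i) n = v := by
    intro v hav hvm i hi
    rcases hmem i v (ha.1.1.trans hav.le) (hvm.trans hm₀') hi with ⟨hv, rfl⟩ | ⟨hv, rfl⟩
    · exact absurd (hmax v ⟨⟨ha.1.1.trans hav.le, hv⟩, hi⟩) (by omega)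
    · obtain ⟨n, rfl⟩ := hi
      have hle : m ≤ n := Nat.find_min' hex ⟨hv, hvm.trans hm₀'⟩
      exact absurd (partialSums_mono (x 1) hle) (by omega)
  exact fun v h₁ h₂ => ⟨key v h₁ h₂ 0, key v h₁ h₂ 1, key v h₁ h₂ 2⟩

lemma not_followsInfinitelyOften_of_blocks (hb : StrictMono b)
    (h : ∀ k i, (∃ n, b k ≤ partialSums (x i) n ∧ partialSums (x i) n < b (k + 1)) ↔
      i = Fin.ofNat 3 k) : ¬ FollowsInfinitelyOften (x 0) (x 2) (x 1) := by
  intro hF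
  obtain ⟨a, ha, c, hac, ⟨n, rfl⟩, ⟨m, rfl⟩, hbetween⟩ := hF (b 0)
  obtain ⟨k, hk, hk'⟩ := hb.exists_block ha
  obtain ⟨l, hl, hl'⟩ := hb.exists_block (ha.trans (le_of_lt hac))
  have h0 := congrArg Fin.val ((h k 0).1 ⟨n, hk, hk'⟩)
  have h2 := congrArg Fin.val ((h l 2).1 ⟨m, hl, hl'⟩)
  simp only [Fin.ofNat] at h0 h2
  have hkl : k < l + 1 := hb.lt_iff_lt.1 (by omega)
  obtain ⟨j, hj, hj'⟩ := (h (k + 1) 1).2 (Fin.ext (by simp only [Fin.ofNat]; omega))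
  have hle : b (k + 2) ≤ b l := hb.monotone <| by
    change 0 = k % 3 at h0
    change 2 = l % 3 at h2
    omega
  exact (hbetween (partialSums (x 1) j) (hk'.trans_le hj) (hj'.trans_le (hle.trans hl))).2.2
    ⟨j, rfl⟩

end Blocks

lemma measurable_exists_partialSums_eq {α : Type*} [MeasurableSpace α] {f : α → ℕ → ℕ}
    (hf : Measurable f) (v : ℕ) : Measurable fun p => ∃ n, partialSums (f p) n = v := by
  have h : ∀ n, Measurable fun p => partialSums (f p) n := fun n =>
    Finset.measurable_sum _ fun j _ => ((measurable_pi_apply j).comp hf).add_const 1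
  exact .exists fun n => measurableSet_setOfPred.1 (h n (measurableSet_singleton v))

lemma measurable_followsInfinitelyOften :
    Measurable fun p : (ℕ → ℕ) × (ℕ → ℕ) × (ℕ → ℕ) =>
      FollowsInfinitelyOften p.1 p.2.1 p.2.2 := by
  have hx := measurable_exists_partialSums_eq
    (measurable_fst (α := ℕ → ℕ) (β := (ℕ → ℕ) × (ℕ → ℕ)))
  have hy := measurable_exists_partialSums_eq
    ((measurable_fst (α := ℕ → ℕ) (β := ℕ → ℕ)).comp
      (measurable_snd (α := ℕ → ℕ) (β := (ℕ → ℕ) × (ℕ → ℕ))))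
  have hz := measurable_exists_partialSums_eq
    ((measurable_snd (α := ℕ → ℕ) (β := ℕ → ℕ)).comp
      (measurable_snd (α := ℕ → ℕ) (β := (ℕ → ℕ) × (ℕ → ℕ))))
  unfold FollowsInfinitelyOften
  refine .forall fun N => .exists fun a => .and measurable_const <| .exists fun b =>
    .and measurable_const <| .and (hx a) <| .and (hy b) <| .forall fun v =>
    .imp measurable_const <| .imp measurable_const <|
    .and (hx v).not <| .and (hy v).not (hz v).not

/-- There is a Borel coloring `c : (ω^ω)³ → Bool` that is not constant on any
block `[T₀] × [T₁] × [T₂]` with superperfect sides: `MRR(I,I,I)` fails for the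
Miller ideal `I`. -/
theorem mrr_miller_three_dimensional_fails :
    ∃ c : (ℕ → ℕ) × (ℕ → ℕ) × (ℕ → ℕ) → Bool, Measurable c ∧
      ∀ T₀ T₁ T₂ : Set (List ℕ),
        IsSuperperfectTree T₀ → IsSuperperfectTree T₁ → IsSuperperfectTree T₂ →
        ∃ p ∈ (branches T₀) ×ˢ ((branches T₁) ×ˢ (branches T₂)),
          ∃ q ∈ (branches T₀) ×ˢ ((branches T₁) ×ˢ (branches T₂)),
            c p ≠ c q := by
  classical
  refine ⟨fun p => decide (FollowsInfinitelyOften p.1 p.2.1 p.2.2),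
    measurable_to_bool ?_, fun T₀ T₁ T₂ h₀ h₁ h₂ => ?_⟩
  · convert measurableSet_setOfPred.2 measurable_followsInfinitelyOften using 1
    ext p
    simp
  obtain ⟨x, b, hx, hb, hxb⟩ := exists_branches_cyclic_blocks (T := ![T₀, T₁, T₂])
    (by intro i; fin_cases i <;> assumption)
  obtain ⟨y, c, hy, hc, hyc⟩ := exists_branches_cyclic_blocks (T := ![T₀, T₂, T₁])
    (by intro i; fin_cases i <;> assumption)
  refine ⟨(x 0, x 1, x 2), ⟨hx 0, hx 1, hx 2⟩, (y 0, y 2, y 1), ⟨hy 0, hy 2, hy 1⟩, ?_⟩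
  simp [followsInfinitelyOften_of_blocks hb hxb, not_followsInfinitelyOften_of_blocks hc hyc]
end

section
/- Let (Bᵢ)ᵢ∈ℕ be E0-positive Borel subsets of 2^ω and let (Cₙ)ₙ∈ℕ be Borel subsets of (2^ω)^ℕ such that {x : ℕ → 2^ω | ∀ i, x i ∈ Bᵢ} ⊆ ⋃ₙ Cₙ. Then there exist an index n and E0-positive Borel sets Bᵢ' ⊆ Bᵢ (for every i ∈ ℕ) such that {x : ℕ → 2^ω | ∀ i, x i ∈ Bᵢ'} ⊆ Cₙ. (MRR(I, I, I, ...) for the E0-ideal I.) -/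
/-- The equivalence relation `E0` on Cantor space: equality modulo finitely
many coordinates. -/
def E0 (x y : ℕ → Bool) : Prop := {n : ℕ | x n ≠ y n}.Finite

/-- A set `B ⊆ 2^ω` is `E0`-small if it is covered by countably many Borel
sets each meeting every `E0`-class in at most one point; otherwise it is
`E0`-positive. -/
def E0Positive (B : Set (ℕ → Bool)) : Prop :=
  ¬ ∃ D : ℕ → Set (ℕ → Bool),
      (∀ n, MeasurableSet (D n)) ∧
      (∀ n, ∀ x ∈ D n, ∀ y ∈ D n, E0 x y → x = y) ∧
      B ⊆ ⋃ n, D n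

open Set Filter Topology

open Classical in
/-- The point `x` with the coordinates in `s` flipped. -/
noncomputable def flipOn {ι : Type} (x : ι → Bool) (s : Set ι) : ι → Bool :=
  fun p => xor (x p) (decide (p ∈ s))

theorem flipOn_of_mem {ι : Type} {x : ι → Bool} {s : Set ι} {p : ι} (h : p ∈ s) :
    flipOn x s p = !x p := by
  simp [flipOn, h]

theorem flipOn_of_notMem {ι : Type} {x : ι → Bool} {s : Set ι} {p : ι} (h : p ∉ s) :
    flipOn x s p = x p := by
  simp [flipOn, h]

theorem flipOn_empty {ι : Type} (x : ι → Bool) : flipOn x ∅ = x := by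
  ext p; simp [flipOn]

theorem flipOn_flipOn {ι : Type} (x : ι → Bool) (s : Set ι) : flipOn (flipOn x s) s = x := by
  ext p; simp [flipOn]

theorem flipOn_union {ι : Type} (x : ι → Bool) {s t : Set ι} (h : Disjoint s t) :
    flipOn x (s ∪ t) = flipOn (flipOn x t) s := by
  ext p
  by_cases hs : p ∈ s
  · simp [flipOn, hs, disjoint_left.1 h hs]
  · by_cases ht : p ∈ t <;> simp [flipOn, hs, ht]

theorem continuous_flipOn {ι : Type} (s : Set ι) :
    Continuous fun x : ι → Bool => flipOn x s :=
  continuous_pi fun p =>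
    (continuous_of_discreteTopology (f := fun b : Bool => xor b _)).comp (continuous_apply p)

/-- Flipping the coordinates in `s` as a homeomorphism. -/
noncomputable def flipHomeomorph {ι : Type} (s : Set ι) : (ι → Bool) ≃ₜ (ι → Bool) where
  toFun x := flipOn x s
  invFun x := flipOn x s
  left_inv x := flipOn_flipOn x s
  right_inv x := flipOn_flipOn x s
  continuous_toFun := continuous_flipOn s
  continuous_invFun := continuous_flipOn s

theorem measurable_flipOn {ι : Type} [Countable ι] (s : Set ι) :
    Measurable fun x : ι → Bool => flipOn x s :=
  (continuous_flipOn s).measurable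

theorem MeasurableSet.exists_complete_covers {X : Type} [TopologicalSpace X] [PolishSpace X]
    [MeasurableSpace X] [BorelSpace X] {B : Set X} (hB : MeasurableSet B) :
    ∃ U : ℕ → ℕ → Set X, (∀ n k, MeasurableSet (U n k)) ∧ (∀ n x, ∃ k, x ∈ U n k) ∧
      ∀ y : ℕ → X, (∀ n, y n ∈ B) → (∀ m, ∃ k, ∀ n, m < n → y n ∈ U m k) →
        ∃ z ∈ B, Tendsto y atTop (𝓝 z) := by
  have key : ∀ (Z : Type) [TopologicalSpace Z] [PolishSpace Z] (f : Z → X),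
      Continuous f → Function.Bijective f → IsClosed (f ⁻¹' B) →
      ∃ U : ℕ → ℕ → Set X, (∀ n k, MeasurableSet (U n k)) ∧ (∀ n x, ∃ k, x ∈ U n k) ∧
      ∀ y : ℕ → X, (∀ n, y n ∈ B) → (∀ m, ∃ k, ∀ n, m < n → y n ∈ U m k) →
        ∃ z ∈ B, Tendsto y atTop (𝓝 z) := by
    intro Z _ _ f hf hbij hcl
    let := TopologicalSpace.upgradeIsCompletelyMetrizable Z
    rcases isEmpty_or_nonempty Z with hZ | hZ
    · refine ⟨fun _ _ => ∅, fun _ _ => MeasurableSet.empty, fun n x => ?_, fun y _ _ => ?_⟩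
      · exact (hZ.false (hbij.2 x).choose).elim
      · exact (hZ.false (hbij.2 (y 0)).choose).elim
    refine ⟨fun n k => f '' Metric.closedBall (TopologicalSpace.denseSeq Z k) ((1 / 2 : ℝ) ^ n),
      fun n k => Metric.isClosed_closedBall.measurableSet_image_of_continuousOn_injOn
        hf.continuousOn hbij.1.injOn, fun n x => ?_, fun y hyB hy => ?_⟩
    · obtain ⟨z, rfl⟩ := hbij.2 x
      obtain ⟨k, hk⟩ := (TopologicalSpace.denseRange_denseSeq Z).exists_dist_lt z
        (pow_pos (by norm_num : (0 : ℝ) < 1 / 2) n)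
      exact ⟨k, z, hk.le, rfl⟩
    · choose z hz using fun n => hbij.2 (y n)
      obtain rfl : y = f ∘ z := funext fun n => (hz n).symm
      have hc : CauchySeq z := by
        rw [Metric.cauchySeq_iff]
        intro ε hε
        obtain ⟨m, hm⟩ := exists_pow_lt_of_lt_one (half_pos hε) (by norm_num : (1 / 2 : ℝ) < 1)
        obtain ⟨k, hk⟩ := hy m
        have hd : ∀ n, m < n → dist (z n) (TopologicalSpace.denseSeq Z k) ≤ (1 / 2 : ℝ) ^ m := by
          intro n hn
          obtain ⟨w, hw, hwz⟩ := hk n hn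
          rw [← hbij.1 hwz]
          exact hw
        refine ⟨m + 1, fun i hi j hj => ?_⟩
        have := dist_triangle_right (z i) (z j) (TopologicalSpace.denseSeq Z k)
        linarith [hd i hi, hd j hj]
      obtain ⟨w, hw⟩ := cauchySeq_tendsto_of_complete hc
      exact ⟨f w, hcl.mem_of_tendsto hw (Eventually.of_forall hyB), (hf.tendsto w).comp hw⟩
  obtain ⟨t', hle, hpol, hcl, -⟩ := hB.isClopenable
  exact @key X t' hpol id (continuous_id_iff_le.2 hle) Function.bijective_id hcl

theorem tendsto_flipOn_of_monotone {ι : Type} {x : ℕ → ι → Bool} {z : ι → Bool}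
    (hx : Tendsto x atTop (𝓝 z)) {s : ℕ → Set ι} (hs : Monotone s) :
    Tendsto (fun n => flipOn (x n) (s n)) atTop (𝓝 (flipOn z (⋃ n, s n))) := by
  rw [tendsto_pi_nhds] at hx ⊢
  intro p
  have h1 := hx p
  rw [nhds_discrete, tendsto_pure] at h1 ⊢
  by_cases hp : p ∈ ⋃ n, s n
  · obtain ⟨m, hm⟩ := mem_iUnion.1 hp
    filter_upwards [h1, eventually_ge_atTop m] with n hn hmn
    rw [flipOn_of_mem hp, flipOn_of_mem (hs hmn hm), hn]
  · filter_upwards [h1] with n hn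
    rw [flipOn_of_notMem hp, flipOn_of_notMem (fun h => hp (mem_iUnion.2 ⟨n, h⟩)), hn]

/-- Fusion: if every Borel set outside the σ-ideal `small` meets some flip of itself in a set
outside `small`, then every such set contains all flips of some point along a sequence of
pairwise disjoint finite sets. -/
theorem exists_flipOn_iUnion_mem {ι : Type} [Countable ι] {small : Set (ι → Bool) → Prop}
    (hempty : small ∅) (hmono : ∀ s t, s ⊆ t → small t → small s)
    (hunion : ∀ s : ℕ → Set (ι → Bool), (∀ n, small (s n)) → small (⋃ n, s n))
    {G : ℕ → Set (Finset ι)}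
    (hG : ∀ P, MeasurableSet P → ¬ small P → ∀ (n : ℕ) (F : Finset ι),
      ∃ g ∈ G n, Disjoint F g ∧ ¬ small (P ∩ {x | flipOn x g ∈ P}))
    {B : Set (ι → Bool)} (hB : MeasurableSet B) (hBs : ¬ small B) :
    ∃ (x : ι → Bool) (g : ℕ → Finset ι), (∀ n, g n ∈ G n) ∧
      (∀ m n, m < n → Disjoint (g m) (g n)) ∧
      ∀ y : Set ℕ, flipOn x (⋃ i ∈ y, (g i : Set ι)) ∈ B := by
  classical
  have : PolishSpace (ι → Bool) := { }
  obtain ⟨U, hUm, hUc, hU⟩ := hB.exists_complete_covers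
  have step : ∀ (n : ℕ) (S : {P : Set (ι → Bool) // MeasurableSet P ∧ ¬ small P} × Finset ι),
      ∃ (g : Finset ι) (Q : {P : Set (ι → Bool) // MeasurableSet P ∧ ¬ small P}),
        g ∈ G n ∧ Disjoint S.2 g ∧ (∀ x ∈ Q.1, x ∈ S.1.1 ∧ flipOn x g ∈ S.1.1) ∧
        ∀ h ⊆ S.2 ∪ g, ∃ k, ∀ x ∈ Q.1, flipOn x h ∈ U n k := by
    rintro n ⟨⟨P, hPm, hPs⟩, F⟩
    obtain ⟨g, hg, hFg, hgs⟩ := hG P hPm hPs n F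
    set Q := P ∩ {x | flipOn x g ∈ P}
    have hQm : MeasurableSet Q := hPm.inter (measurable_flipOn _ hPm)
    let R : ((F ∪ g).powerset → ℕ) → Set (ι → Bool) := fun κ =>
      Q ∩ ⋂ h : (F ∪ g).powerset, (fun x => flipOn x (h : Finset ι)) ⁻¹' U n (κ h)
    obtain ⟨κ, hκ⟩ : ∃ κ, ¬ small (R κ) := by
      by_contra! hcon
      obtain ⟨e, he⟩ := exists_surjective_nat ((F ∪ g).powerset → ℕ)
      refine hgs (hmono _ _ ?_ (hunion (fun n => R (e n)) fun n => hcon _))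
      intro x hx
      choose κ hκ using fun h : (F ∪ g).powerset => hUc n (flipOn x (h : Finset ι))
      obtain ⟨m, rfl⟩ := he κ
      exact mem_iUnion.2 ⟨m, hx, mem_iInter.2 hκ⟩
    refine ⟨g, ⟨R κ, hQm.inter (MeasurableSet.iInter fun h => measurable_flipOn _ (hUm _ _)), hκ⟩,
      hg, hFg, fun x hx => hx.1, fun h hh => ⟨κ ⟨h, Finset.mem_powerset.2 hh⟩, fun x hx => ?_⟩⟩
    exact mem_iInter.1 hx.2 ⟨h, Finset.mem_powerset.2 hh⟩
  choose gs Qs hgG hgF hgQ hgU using step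
  let S : ℕ → {P : Set (ι → Bool) // MeasurableSet P ∧ ¬ small P} × Finset ι := fun n =>
    Nat.rec (⟨B, hB, hBs⟩, ∅) (fun n T => (Qs n T, T.2 ∪ gs n T)) n
  let g : ℕ → Finset ι := fun n => gs n (S n)
  have hSF : ∀ n, (S (n + 1)).2 = (S n).2 ∪ g n := fun n => rfl
  have hgS : ∀ m n, m < n → g m ⊆ (S n).2 := by
    intro m n hmn
    induction n with
    | zero => omega
    | succ n ih =>
      rw [hSF]
      rcases Nat.lt_succ_iff_lt_or_eq.1 hmn with h | rfl
      · exact (ih h).trans Finset.subset_union_left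
      · exact Finset.subset_union_right
  have hne : ∀ n, (S n).1.1.Nonempty := by
    intro n
    rw [nonempty_iff_ne_empty]
    intro h
    exact (S n).1.2.2 (h ▸ hempty)
  choose x hx using hne
  let a : Set ℕ → ℕ → Finset ι := fun y n => {i ∈ Finset.range n | i ∈ y}.biUnion g
  have haS : ∀ y n, a y n ⊆ (S n).2 := by
    intro y n
    refine Finset.biUnion_subset.2 fun i hi => hgS i n ?_
    simpa using (Finset.mem_filter.1 hi).1
  have hasucc : ∀ y n, a y (n + 1) = a y n ∪ (if n ∈ y then g n else ∅) := by
    intro y n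
    by_cases hn : n ∈ y
    · simp only [a, Finset.range_add_one, Finset.filter_insert, hn, if_true, Finset.biUnion_insert,
        Finset.union_comm]
    · simp only [a, Finset.range_add_one, Finset.filter_insert, hn, if_false,
        Finset.union_empty]
  have hdesc : ∀ y m d, ∀ w ∈ (S (m + d)).1.1, ∃ w' ∈ (S m).1.1,
      flipOn w (a y (m + d)) = flipOn w' (a y m) := by
    intro y m d
    induction d with
    | zero => exact fun w hw => ⟨w, hw, rfl⟩
    | succ d ih =>
      intro w hw
      have hw' := hgQ _ _ w hw
      rw [← add_assoc, hasucc]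
      split_ifs with h
      · rw [Finset.coe_union, flipOn_union]
        · exact ih _ hw'.2
        · exact Finset.disjoint_coe.2 (Finset.disjoint_of_subset_left (haS y _) (hgF _ _))
      · rw [Finset.union_empty]
        exact ih _ hw'.1
  have hlim : ∀ y, ∃ z ∈ B, Tendsto (fun n => flipOn (x n) (a y n)) atTop (𝓝 z) := by
    intro y
    apply hU
    · intro n
      obtain ⟨w, hw, hwe⟩ := hdesc y 0 n (x (0 + n)) (hx _)
      rw [zero_add] at hwe
      have h0 : (a y 0 : Set ι) = ∅ := by simp [a]
      rw [hwe, h0, flipOn_empty]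
      exact hw
    · intro m
      obtain ⟨k, hk⟩ := hgU m (S m) (a y (m + 1)) (haS y (m + 1))
      refine ⟨k, fun n hn => ?_⟩
      obtain ⟨d, rfl⟩ := Nat.exists_eq_add_of_le hn
      obtain ⟨w, hw, hwe⟩ := hdesc y (m + 1) d (x (m + 1 + d)) (hx _)
      rw [Nat.succ_eq_add_one, hwe]
      exact hk w hw
  obtain ⟨z, -, hz⟩ := hlim ∅
  have hz' : Tendsto x atTop (𝓝 z) := by
    have h0 : ∀ n, (a ∅ n : Set ι) = ∅ := by simp [a]
    simpa only [h0, flipOn_empty] using hz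
  refine ⟨z, g, fun n => hgG _ _, fun m n hmn =>
    Finset.disjoint_of_subset_left (hgS m n hmn) (hgF _ _), fun y => ?_⟩
  obtain ⟨w, hwB, hw⟩ := hlim y
  have hmon : Monotone fun n => (a y n : Set ι) :=
    monotone_nat_of_le_succ fun n =>
      Finset.coe_subset.2 ((hasucc y n).symm ▸ Finset.subset_union_left)
  have hU : (⋃ i ∈ y, (g i : Set ι)) = ⋃ n, (a y n : Set ι) := by
    ext p
    simp only [a, mem_iUnion, Finset.coe_biUnion, Finset.mem_coe, Finset.mem_filter,
      Finset.mem_range, exists_prop]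
    exact ⟨fun ⟨i, hi, hp⟩ => ⟨i + 1, i, ⟨i.lt_succ_self, hi⟩, hp⟩,
      fun ⟨_, i, hi, hp⟩ => ⟨i, hi.2, hp⟩⟩
  rw [hU, ← tendsto_nhds_unique hw (tendsto_flipOn_of_monotone hz' hmon)]
  exact hwB

theorem exists_flipOn_singleton_not_isMeagre {ι : Type} [Countable ι] {P : Set (ι → Bool)}
    (hP : MeasurableSet P) (hPn : ¬ IsMeagre P) {J : Set ι} (hJ : J.Infinite) :
    ∃ p ∈ J, ¬ IsMeagre (P ∩ {x | flipOn x {p} ∈ P}) := by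
  obtain ⟨u, hu, hPu⟩ := hP.residualEq_isOpen
  obtain ⟨x, hx⟩ : u.Nonempty := by
    rw [nonempty_iff_ne_empty]
    rintro rfl
    refine hPn ?_
    rw [IsMeagre]
    filter_upwards [hPu] with x hx hxP
    exact hx.mp hxP
  have hJt : Tendsto (fun n => flipOn x {(hJ.natEmbedding J n : ι)}) atTop (𝓝 x) := by
    rw [tendsto_pi_nhds]
    intro p
    rw [nhds_discrete, tendsto_pure]
    have hfin : {n | (hJ.natEmbedding J n : ι) = p}.Finite :=
      Set.Subsingleton.finite fun m hm n hn =>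
        (hJ.natEmbedding J).injective (Subtype.ext (hm.trans hn.symm))
    filter_upwards [Nat.cofinite_eq_atTop ▸ hfin.eventually_cofinite_notMem] with n hn
    exact flipOn_of_notMem fun h => hn (mem_singleton_iff.1 h).symm
  obtain ⟨n, hn⟩ := (hJt.eventually (hu.mem_nhds hx)).exists
  set p : ι := (hJ.natEmbedding J n).1
  refine ⟨p, (hJ.natEmbedding J n).2, fun hmeagre => ?_⟩
  have hopen : IsOpen (u ∩ {x | flipOn x {p} ∈ u}) := hu.inter (hu.preimage (continuous_flipOn _))
  refine not_isMeagre_of_isOpen hopen ⟨x, hx, hn⟩ ?_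
  have hPu' := (tendsto_residual_of_isOpenMap (flipHomeomorph {p}).continuous
    (flipHomeomorph {p}).isOpenMap).eventually hPu
  rw [IsMeagre] at hmeagre ⊢
  filter_upwards [hPu, hPu', hmeagre] with y hy hy' hyn hyu
  exact hyn ⟨hy.mpr hyu.1, hy'.mpr hyu.2⟩

/-- A set covered by countably many Borel partial transversals of `E0`. -/
def E0Small (B : Set (ℕ → Bool)) : Prop :=
  ∃ D : ℕ → Set (ℕ → Bool),
    (∀ n, MeasurableSet (D n)) ∧
    (∀ n, ∀ x ∈ D n, ∀ y ∈ D n, E0 x y → x = y) ∧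
    B ⊆ ⋃ n, D n

theorem E0Small.mono {s t : Set (ℕ → Bool)} (hst : s ⊆ t) (ht : E0Small t) : E0Small s := by
  obtain ⟨D, h1, h2, h3⟩ := ht
  exact ⟨D, h1, h2, hst.trans h3⟩

theorem E0Small.iUnion {κ : Type} [Countable κ] {s : κ → Set (ℕ → Bool)}
    (hs : ∀ n, E0Small (s n)) : E0Small (⋃ n, s n) := by
  choose D h1 h2 h3 using hs
  rcases isEmpty_or_nonempty κ with hκ | hκ
  · exact ⟨fun _ => ∅, fun _ => MeasurableSet.empty, fun _ _ h => h.elim, by simp⟩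
  obtain ⟨e, he⟩ := exists_surjective_nat (κ × ℕ)
  refine ⟨fun n => D (e n).1 (e n).2, fun n => h1 _ _, fun n => h2 _ _,
    iUnion_subset fun i x hx => ?_⟩
  obtain ⟨k, hk⟩ := mem_iUnion.1 (h3 i hx)
  obtain ⟨n, hn⟩ := he (i, k)
  exact mem_iUnion.2 ⟨n, by rw [hn]; exact hk⟩

theorem E0Small.of_transversal {s : Set (ℕ → Bool)} (hs : MeasurableSet s)
    (ht : ∀ x ∈ s, ∀ y ∈ s, E0 x y → x = y) : E0Small s :=
  ⟨fun _ => s, fun _ => hs, fun _ => ht, (iUnion_const s).ge⟩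

theorem exists_flipOn_not_E0Small {P : Set (ℕ → Bool)} (hP : MeasurableSet P)
    (hPs : ¬ E0Small P) (F : Finset ℕ) :
    ∃ g : Finset ℕ, g.Nonempty ∧ Disjoint F g ∧ ¬ E0Small (P ∩ {x | flipOn x g ∈ P}) := by
  by_contra! hcon
  have hmeas : ∀ g : Finset ℕ, MeasurableSet {x | flipOn x g ∈ P} :=
    fun g => measurable_flipOn _ hP
  let Q : Set (ℕ → Bool) := P \ ⋃ g : {g : Finset ℕ // g.Nonempty ∧ Disjoint F g},
    {x | flipOn x (g : Finset ℕ) ∈ P}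
  have hQm : MeasurableSet Q := hP.diff (MeasurableSet.iUnion fun g => hmeas g)
  have hQ : ∀ s : F → Bool, E0Small (Q ∩ {x | ∀ i : F, x i = s i}) := by
    intro s
    refine .of_transversal (hQm.inter ?_) ?_
    · rw [ofPred_forall]
      exact MeasurableSet.iInter fun i => measurableSet_eq_fun (measurable_pi_apply _)
        measurable_const
    rintro x ⟨hxQ, hxs⟩ y ⟨hyQ, hys⟩ hxy
    by_contra hne
    have hcoe : (hxy.toFinset : Set ℕ) = {n | x n ≠ y n} := hxy.coe_toFinset
    refine hxQ.2 (mem_iUnion.2 ⟨⟨hxy.toFinset, ?_, ?_⟩, ?_⟩)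
    · obtain ⟨n, hn⟩ := Function.ne_iff.1 hne
      exact ⟨n, hxy.mem_toFinset.2 hn⟩
    · refine Finset.disjoint_left.2 fun n hn hn' => hxy.mem_toFinset.1 hn' ?_
      rw [hxs ⟨n, hn⟩, hys ⟨n, hn⟩]
    · have : flipOn x (hxy.toFinset : Set ℕ) = y := by
        ext n
        rw [hcoe]
        by_cases hn : x n = y n
        · rw [flipOn_of_notMem (by simpa using hn), hn]
        · rw [flipOn_of_mem hn]
          exact (Bool.eq_not_of_ne (Ne.symm hn)).symm
      simpa only [mem_ofPred_eq, this] using hyQ.1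
  refine hPs (.mono ?_ (.iUnion (κ := Bool) (s := fun b => bif b then
    ⋃ g : {g : Finset ℕ // g.Nonempty ∧ Disjoint F g}, P ∩ {x | flipOn x (g : Finset ℕ) ∈ P}
    else ⋃ s : F → Bool, Q ∩ {x | ∀ i : F, x i = s i}) ?_))
  · intro x hx
    by_cases hxg : x ∈ ⋃ g : {g : Finset ℕ // g.Nonempty ∧ Disjoint F g},
        {x | flipOn x (g : Finset ℕ) ∈ P}
    · obtain ⟨g, hg⟩ := mem_iUnion.1 hxg
      exact mem_iUnion.2 ⟨true, mem_iUnion.2 ⟨g, hx, hg⟩⟩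
    · exact mem_iUnion.2 ⟨false, mem_iUnion.2 ⟨fun i => x i, ⟨hx, hxg⟩, fun _ => rfl⟩⟩
  · rintro (_ | _)
    · exact .iUnion hQ
    · exact .iUnion fun g => hcon g g.2.1 g.2.2

/-- Continuous injections of Cantor space into itself which preserve `E0`. -/
structure IsE0Embedding (h : (ℕ → Bool) → (ℕ → Bool)) : Prop where
  continuous : Continuous h
  injective : Function.Injective h
  map_E0 : ∀ x y, E0 x y → E0 (h x) (h y)

theorem IsE0Embedding.comp {h k : (ℕ → Bool) → (ℕ → Bool)} (hh : IsE0Embedding h)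
    (hk : IsE0Embedding k) : IsE0Embedding (h ∘ k) :=
  ⟨hh.continuous.comp hk.continuous, hh.injective.comp hk.injective,
    fun x y hxy => hh.map_E0 _ _ (hk.map_E0 x y hxy)⟩

theorem IsE0Embedding.measurableSet_range {h : (ℕ → Bool) → (ℕ → Bool)} (hh : IsE0Embedding h) :
    MeasurableSet (range h) :=
  (isCompact_range hh.continuous).isClosed.measurableSet

theorem IsE0Embedding.e0Positive_range {h : (ℕ → Bool) → (ℕ → Bool)} (hh : IsE0Embedding h) :
    E0Positive (range h) := by
  rintro ⟨D, hDm, hDt, hD⟩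
  obtain ⟨n, hn⟩ : ∃ n, ¬ IsMeagre (h ⁻¹' D n) := by
    by_contra! hcon
    refine not_isMeagre_of_isOpen isOpen_univ univ_nonempty
      ((isMeagre_iUnion hcon).mono fun x _ => ?_)
    obtain ⟨n, hn⟩ := mem_iUnion.1 (hD (mem_range_self x))
    exact mem_iUnion.2 ⟨n, hn⟩
  obtain ⟨p, -, hp⟩ := exists_flipOn_singleton_not_isMeagre (hh.continuous.measurable (hDm n)) hn
    infinite_univ
  obtain ⟨x, hx, hx'⟩ : ((h ⁻¹' D n) ∩ {x | flipOn x {p} ∈ h ⁻¹' D n}).Nonempty := by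
    rw [nonempty_iff_ne_empty]
    intro h0
    exact hp (h0 ▸ IsMeagre.empty)
  have hE : E0 x (flipOn x {p}) := by
    refine (finite_singleton p).subset fun q hq => ?_
    by_contra hqp
    exact hq (flipOn_of_notMem hqp).symm
  have := congrFun (hh.injective (hDt n _ hx _ hx' (hh.map_E0 _ _ hE))) p
  rw [flipOn_of_mem (mem_singleton p)] at this
  simp at this

theorem isE0Embedding_flipOn_iUnion (x : ℕ → Bool) {g : ℕ → Finset ℕ}
    (hne : ∀ n, (g n).Nonempty) (hdisj : ∀ m n, m ≠ n → Disjoint (g m) (g n)) :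
    IsE0Embedding fun v => flipOn x (⋃ i ∈ {i | v i = true}, (g i : Set ℕ)) := by
  have hval : ∀ (v : ℕ → Bool) (i p : ℕ), p ∈ g i →
      flipOn x (⋃ i ∈ {i | v i = true}, (g i : Set ℕ)) p = xor (x p) (v i) := by
    intro v i p hp
    have : p ∈ (⋃ i ∈ {i | v i = true}, (g i : Set ℕ)) ↔ v i = true := by
      simp only [mem_iUnion, mem_ofPred_eq, Finset.mem_coe, exists_prop]
      refine ⟨fun ⟨j, hj, hpj⟩ => ?_, fun h => ⟨i, h, hp⟩⟩
      by_contra hi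
      exact Finset.disjoint_left.1 (hdisj i j (by rintro rfl; exact hi hj)) hp hpj
    simp only [flipOn, this, Bool.decide_eq_true]
  have hval' : ∀ (v : ℕ → Bool) (p : ℕ), (∀ i, p ∉ g i) →
      flipOn x (⋃ i ∈ {i | v i = true}, (g i : Set ℕ)) p = x p := by
    intro v p hp
    refine flipOn_of_notMem ?_
    simp [hp]
  refine ⟨continuous_pi fun p => ?_, fun v w hvw => funext fun i => ?_, fun v w hvw => ?_⟩
  · by_cases hp : ∃ i, p ∈ g i
    · obtain ⟨i, hi⟩ := hp
      simp only [hval _ i p hi]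
      exact (continuous_of_discreteTopology (f := fun b : Bool => xor (x p) b)).comp
        (continuous_apply i)
    · simp only [hval' _ p (not_exists.1 hp)]
      exact continuous_const
  · obtain ⟨p, hp⟩ := hne i
    have := congrFun hvw p
    simp only [hval _ i p hp] at this
    simpa using this
  · refine (hvw.biUnion fun i _ => (g i).finite_toSet).subset fun p hp => ?_
    by_cases hpi : ∃ i, p ∈ g i
    · obtain ⟨i, hi⟩ := hpi
      refine mem_biUnion (x := i) (fun hvi => hp ?_) hi
      simp only [hval _ i p hi, hvi]
    · refine absurd ?_ hp
      simp only [hval' _ p (not_exists.1 hpi)]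

theorem E0Positive.exists_isE0Embedding {B : Set (ℕ → Bool)} (hB : MeasurableSet B)
    (hpos : E0Positive B) : ∃ h, IsE0Embedding h ∧ ∀ v, h v ∈ B := by
  obtain ⟨x, g, hg, hdisj, hxB⟩ := exists_flipOn_iUnion_mem (small := E0Small)
    (G := fun _ => {g | g.Nonempty})
    (.of_transversal MeasurableSet.empty fun _ h => h.elim) (fun _ _ => .mono) (fun _ => .iUnion)
    (fun P hP hPs _ F => exists_flipOn_not_E0Small hP hPs F) hB hpos
  refine ⟨_, isE0Embedding_flipOn_iUnion x hg fun m n hmn => ?_, fun v => hxB _⟩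
  exact hmn.lt_or_gt.elim (hdisj m n) fun h => (hdisj n m h).symm

theorem exists_isE0Embedding_pi_mem {C : Set (ℕ × ℕ → Bool)} (hC : MeasurableSet C)
    (hCn : ¬ IsMeagre C) : ∃ t : ℕ → (ℕ → Bool) → (ℕ → Bool), (∀ i, IsE0Embedding (t i)) ∧
      ∀ v : ℕ → ℕ → Bool, (fun q : ℕ × ℕ => t q.1 (v q.1) q.2) ∈ C := by
  obtain ⟨x, g, hg, hdisj, hxC⟩ := exists_flipOn_iUnion_mem (small := IsMeagre)
    (G := fun n => {g | ∃ p, g = {((Nat.unpair n).1, p)}})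
    IsMeagre.empty (fun _ _ h ht => ht.mono h) (fun _ => isMeagre_iUnion)
    (fun P hP hPs n F => by
      have hJ : (range (Prod.mk (Nat.unpair n).1) \ (F : Set (ℕ × ℕ))).Infinite :=
        (infinite_range_of_injective (Prod.mk_right_injective _)).sdiff F.finite_toSet
      obtain ⟨_, ⟨⟨p, rfl⟩, hpF⟩, hp⟩ := exists_flipOn_singleton_not_isMeagre hP hPs hJ
      refine ⟨_, ⟨p, rfl⟩, Finset.disjoint_singleton_right.2 hpF, ?_⟩
      rwa [Finset.coe_singleton]) hC hCn
  choose p hp using hg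
  refine ⟨fun i v => flipOn (fun j => x (i, j))
    (⋃ k ∈ {k | v k = true}, (({p (Nat.pair i k)} : Finset ℕ) : Set ℕ)), fun i => ?_, fun v => ?_⟩
  · refine isE0Embedding_flipOn_iUnion _ (fun _ => Finset.singleton_nonempty _) fun k l hkl => ?_
    have hd : Disjoint (g (Nat.pair i k)) (g (Nat.pair i l)) := by
      have hkl' : Nat.pair i k ≠ Nat.pair i l := by simpa [Nat.pair_eq_pair] using hkl
      exact hkl'.lt_or_gt.elim (hdisj _ _) fun h => (hdisj _ _ h).symm
    rw [hp, hp] at hd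
    simpa using hd
  · convert hxC {m | v (Nat.unpair m).1 (Nat.unpair m).2 = true} using 1
    ext ⟨i, j⟩
    have hmem : j ∈ (⋃ k ∈ {k | v i k = true}, (({p (Nat.pair i k)} : Finset ℕ) : Set ℕ)) ↔
        (i, j) ∈ (⋃ m ∈ {m | v (Nat.unpair m).1 (Nat.unpair m).2 = true},
          (g m : Set (ℕ × ℕ))) := by
      simp only [mem_iUnion, mem_ofPred_eq, Finset.mem_coe, exists_prop, hp, Finset.mem_singleton,
        Prod.mk.injEq]
      constructor
      · rintro ⟨k, hk, rfl⟩
        exact ⟨Nat.pair i k, by simpa using hk, by simp, rfl⟩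
      · rintro ⟨m, hm, rfl, rfl⟩
        exact ⟨(Nat.unpair m).2, hm, by simp⟩
    exact congrArg (xor (x (i, j))) (decide_eq_decide.2 hmem)

/-- Countable-dimensional rectangular Ramsey property `MRR(I, I, I, ...)` for
the `E0`-ideal `I`. -/
theorem mrr_E0_ideal_product
    (B : ℕ → Set (ℕ → Bool))
    (hBmeas : ∀ i, MeasurableSet (B i))
    (hBpos : ∀ i, E0Positive (B i))
    (C : ℕ → Set (ℕ → (ℕ → Bool)))
    (hCmeas : ∀ n, MeasurableSet (C n))
    (hcov : {x : ℕ → (ℕ → Bool) | ∀ i, x i ∈ B i} ⊆ ⋃ n, C n) :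
    ∃ (n : ℕ) (B' : ℕ → Set (ℕ → Bool)),
      (∀ i, MeasurableSet (B' i)) ∧ (∀ i, E0Positive (B' i)) ∧
      (∀ i, B' i ⊆ B i) ∧
      {x : ℕ → (ℕ → Bool) | ∀ i, x i ∈ B' i} ⊆ C n := by
  choose h hh hhB using fun i => (hBpos i).exists_isE0Embedding (hBmeas i)
  let H : (ℕ × ℕ → Bool) → ℕ → ℕ → Bool := fun w i => h i fun j => w (i, j)
  have hH : Continuous H := continuous_pi fun i =>
    (hh i).continuous.comp (continuous_pi fun j => continuous_apply (i, j))
  obtain ⟨n, hn⟩ : ∃ n, ¬ IsMeagre (H ⁻¹' C n) := by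
    by_contra! hcon
    refine not_isMeagre_of_isOpen isOpen_univ univ_nonempty
      ((isMeagre_iUnion hcon).mono fun w _ => ?_)
    obtain ⟨n, hn⟩ := mem_iUnion.1 (hcov fun i => hhB i fun j => w (i, j))
    exact mem_iUnion.2 ⟨n, hn⟩
  obtain ⟨t, ht, htC⟩ := exists_isE0Embedding_pi_mem (hH.measurable (hCmeas n)) hn
  have hht : ∀ i, IsE0Embedding (h i ∘ t i) := fun i => (hh i).comp (ht i)
  refine ⟨n, fun i => range (h i ∘ t i), fun i => (hht i).measurableSet_range,
    fun i => (hht i).e0Positive_range, fun i => range_subset_iff.2 fun v => hhB i _,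
    fun x hx => ?_⟩
  choose v hv using hx
  have hxv : x = H fun q => t q.1 (v q.1) q.2 := funext fun i => (hv i).symm
  rw [hxv]
  exact htC v
end

section
/- Let μ be the fair-coin product probability measure on 2^ω. For every Borel set A ⊆ 2^ω with μ(A) > 0 and every Laver tree T on ℕ, the set {a ∘ b : a ∈ A, b ∈ [T]} (where (a ∘ b)(n) = a(b(n))) has nonempty interior in 2^ω. -/
open MeasureTheory

/-- The fair-coin product probability measure on Cantor space `2^ω`,
characterized by its values on cylinders: each basic cylinder determined by
the first `n` coordinates has measure `2⁻ⁿ`. -/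
def IsFairCoinMeasure (μ : Measure (ℕ → Bool)) : Prop :=
  IsProbabilityMeasure μ ∧
    ∀ (n : ℕ) (s : ℕ → Bool), μ {x | ∀ i < n, x i = s i} = (2 : ENNReal)⁻¹ ^ n

/-- A Laver tree: a tree on `ℕ` with a stem comparable with every node, all of
whose extensions in the tree have infinitely many immediate successors. -/
def IsLaverTree (T : Set (List ℕ)) : Prop :=
  IsTreeOnNat T ∧
    ∃ s ∈ T, (∀ t ∈ T, t <+: s ∨ s <+: t) ∧
      ∀ t ∈ T, s <+: t → {m : ℕ | t ++ [m] ∈ T}.Infinite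

open Set

/-- Under a fair-coin measure, prescribing the first `n` coordinates together with the coordinates
of `S` in `[n, n + d)` has probability at most `2⁻¹` to the number of prescribed coordinates. -/
lemma IsFairCoinMeasure.measure_cylinder_inter_le {μ : Measure (ℕ → Bool)}
    (hμ : IsFairCoinMeasure μ) (S : Set ℕ) [DecidablePred (· ∈ S)] (j : Bool) (d n : ℕ)
    (s : ℕ → Bool) :
    μ {x | (∀ i < n, x i = s i) ∧ ∀ i, n ≤ i → i < n + d → i ∈ S → x i = j} ≤
      (2 : ENNReal)⁻¹ ^ (n + ((Finset.Ico n (n + d)).filter (· ∈ S)).card) := by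
  induction d generalizing n s with
  | zero =>
    simpa using (measure_mono fun x hx => hx.1).trans (hμ.2 n s).le
  | succ d ih =>
    have key (b : Bool) := ih (n + 1) (Function.update s n b)
    have hI : Finset.Ico n (n + (d + 1)) = insert n (Finset.Ico (n + 1) (n + 1 + d)) := by
      ext i
      simp only [Finset.mem_Ico, Finset.mem_insert]
      omega
    have hsub {x : ℕ → Bool}
        (hx : (∀ i < n, x i = s i) ∧ ∀ i, n ≤ i → i < n + (d + 1) → i ∈ S → x i = j) :
        (∀ i < n + 1, x i = Function.update s n (x n) i) ∧
          ∀ i, n + 1 ≤ i → i < n + 1 + d → i ∈ S → x i = j := by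
      refine ⟨fun i hi => ?_, fun i h1 h2 => hx.2 i (by omega) (by omega)⟩
      rcases eq_or_ne i n with rfl | hne
      · simp
      · rw [Function.update_of_ne hne]
        exact hx.1 i (by omega)
    rw [hI, Finset.filter_insert]
    by_cases hn : n ∈ S
    · rw [if_pos hn, Finset.card_insert_of_notMem (by simp)]
      refine (measure_mono fun x hx => ?_).trans ((key j).trans_eq (congrArg _ (by omega)))
      have := hsub hx
      rwa [hx.2 n le_rfl (by omega) hn] at this
    · rw [if_neg hn]
      refine (measure_mono fun x hx => ?_).trans
        ((measure_union_le _ _).trans (add_le_add (key true) (key false))) |>.trans_eq ?_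
      · have := hsub hx
        cases h : x n <;> rw [h] at this
        · exact Or.inr this
        · exact Or.inl this
      · rw [← two_mul, add_right_comm, pow_succ', ← mul_assoc,
          ENNReal.mul_inv_cancel two_ne_zero ENNReal.ofNat_ne_top, one_mul]

/-- Almost surely, a sequence of fair coin tosses is not constant on a given infinite set. -/
lemma IsFairCoinMeasure.measure_forall_mem_eq_zero {μ : Measure (ℕ → Bool)}
    (hμ : IsFairCoinMeasure μ) {S : Set ℕ} (hS : S.Infinite) (j : Bool) :
    μ {x | ∀ i ∈ S, x i = j} = 0 := by
  classical
  refine le_antisymm (ge_of_tendsto'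
    (ENNReal.tendsto_pow_atTop_nhds_zero_of_lt_one ENNReal.one_half_lt_one) fun n => ?_) zero_le
  obtain ⟨F, hF, hcard⟩ := hS.exists_subset_card_eq n
  obtain ⟨N, hN⟩ := F.exists_nat_subset_range
  refine (measure_mono fun x hx => ?_).trans
    ((hμ.measure_cylinder_inter_le S j N 0 fun _ => false).trans ?_)
  · exact ⟨fun i hi => absurd hi (by omega), fun i _ _ hi => hx i hi⟩
  · refine pow_le_pow_right_of_le_one' ENNReal.one_half_lt_one.le ?_
    rw [zero_add, zero_add, ← hcard]
    refine Finset.card_le_card fun i hi => ?_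
    simpa using ⟨Finset.mem_range.1 (hN hi), hF hi⟩

/-- A set of positive fair-coin measure still has positive measure after prescribing the value of
some coordinate from a given infinite set. -/
lemma IsFairCoinMeasure.exists_measure_inter_pos {μ : Measure (ℕ → Bool)}
    (hμ : IsFairCoinMeasure μ) {S : Set ℕ} (hS : S.Infinite) (j : Bool) {K : Set (ℕ → Bool)}
    (hK : 0 < μ K) : ∃ m ∈ S, 0 < μ (K ∩ {x | x m = j}) := by
  by_contra! h
  refine hK.ne' (measure_mono_null (fun x hx => ?_) (measure_union_null
    (measure_iUnion_null fun m : S => le_antisymm (h m m.2) zero_le)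
    (hμ.measure_forall_mem_eq_zero hS (!j))))
  by_cases hxS : ∃ m ∈ S, x m = j
  · obtain ⟨m, hm, hxm⟩ := hxS
    exact Or.inl (mem_iUnion.2 ⟨⟨m, hm⟩, hx, hxm⟩)
  · push Not at hxS
    exact Or.inr fun i hi => Bool.eq_not.2 (hxS i hi)

/-- A strictly growing chain of nodes of a tree determines a branch. -/
lemma IsTreeOnNat.exists_mem_branches {T : Set (List ℕ)} (hT : IsTreeOnNat T) (t : ℕ → List ℕ)
    (htT : ∀ n, t n ∈ T) (ht : ∀ n, ∃ m, t (n + 1) = t n ++ [m]) :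
    ∃ b ∈ branches T, ∀ i, (t (i + 1))[i]? = some (b i) := by
  have hlen (n : ℕ) : n ≤ (t n).length := by
    induction n with
    | zero => simp
    | succ n ih =>
      obtain ⟨m, hm⟩ := ht n
      simpa [hm] using ih
  have hpre {n k : ℕ} (h : n ≤ k) : t n <+: t k := by
    induction k, h using Nat.le_induction with
    | base => exact List.prefix_rfl
    | succ k _ ih =>
      obtain ⟨m, hm⟩ := ht k
      exact hm ▸ ih.trans (List.prefix_append _ _)
  have hlt (i : ℕ) : i < (t (i + 1)).length := hlen (i + 1)
  refine ⟨fun i => (t (i + 1))[i]'(hlt i), fun n => ?_, fun i => List.getElem?_eq_getElem (hlt i)⟩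
  refine hT (t n) (htT n) _ (List.prefix_iff_eq_take.2 (List.ext_getElem ?_ fun i h1 h2 => ?_))
  · simp [hlen n]
  · simp only [List.length_ofFn] at h1
    simp only [List.getElem_ofFn, List.getElem_take]
    exact (hpre (Nat.succ_le_of_lt h1)).getElem (hlt i)

/-- If `a ∘ s` is an initial segment of `c` for all `a` in a closed set `K` of positive measure,
then `c = a ∘ b` for some `a ∈ K` and some branch `b` of a Laver tree with stem `s`. -/
lemma IsFairCoinMeasure.exists_eq_comp_branch {μ : Measure (ℕ → Bool)}
    (hμ : IsFairCoinMeasure μ) {T : Set (List ℕ)} (hT : IsTreeOnNat T) {s : List ℕ} (hs : s ∈ T)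
    (hsplit : ∀ t ∈ T, s <+: t → {m : ℕ | t ++ [m] ∈ T}.Infinite)
    {K : Set (ℕ → Bool)} (hK : IsClosed K) (hKpos : 0 < μ K) {c : ℕ → Bool}
    (hc : ∀ a ∈ K, ∀ i m, s[i]? = some m → a m = c i) :
    ∃ a ∈ K, ∃ b ∈ branches T, c = fun n => a (b n) := by
  let P : List ℕ × Set (ℕ → Bool) → Prop := fun p =>
    p.1 ∈ T ∧ s <+: p.1 ∧ IsClosed p.2 ∧ 0 < μ p.2 ∧
      ∀ a ∈ p.2, ∀ i m, p.1[i]? = some m → a m = c i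
  have step (p : Subtype P) : ∃ q : Subtype P,
      (∃ m, q.1.1 = p.1.1 ++ [m]) ∧ q.1.2 ⊆ p.1.2 := by
    obtain ⟨⟨t, L⟩, htT, hst, hL, hLpos, hLc⟩ := p
    obtain ⟨m, hm, hpos⟩ := hμ.exists_measure_inter_pos (hsplit t htT hst) (c t.length) hLpos
    refine ⟨⟨(t ++ [m], L ∩ {x | x m = c t.length}), hm, hst.trans (List.prefix_append _ _),
      hL.inter (isClosed_eq (continuous_apply m) continuous_const), hpos, ?_⟩,
      ⟨m, rfl⟩, inter_subset_left⟩
    rintro a ⟨haL, ham⟩ i k hik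
    rcases lt_trichotomy i t.length with h | rfl | h
    · exact hLc a haL i k (by rwa [List.getElem?_append_left h] at hik)
    · obtain rfl : m = k := by simpa using hik
      exact ham
    · rw [List.getElem?_eq_none (by simpa using h)] at hik
      cases hik
  choose next hnext hsub using step
  let p₀ : Subtype P := ⟨(s, K), hs, List.prefix_rfl, hK, hKpos, hc⟩
  let p : ℕ → Subtype P := fun n => next^[n] p₀
  have hp (n : ℕ) : p (n + 1) = next (p n) := Function.iterate_succ_apply' _ _ _
  obtain ⟨b, hb, hbp⟩ := hT.exists_mem_branches (fun n => (p n).1.1) (fun n => (p n).2.1)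
    fun n => hp n ▸ hnext (p n)
  obtain ⟨a, ha⟩ := IsCompact.nonempty_iInter_of_sequence_nonempty_isCompact_isClosed
    (fun n => (p n).1.2) (fun n => hp n ▸ hsub (p n))
    (fun n => nonempty_of_measure_ne_zero (p n).2.2.2.2.1.ne')
    (p 0).2.2.2.1.isCompact fun n => (p n).2.2.2.1
  rw [mem_iInter] at ha
  exact ⟨a, ha 0, b, hb, funext fun i =>
    ((p (i + 1)).2.2.2.2.2 a (ha (i + 1)) i (b i) (hbp i)).symm⟩

/-- For every Borel `A ⊆ 2^ω` of positive fair-coin measure and every Laver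
tree `T`, the set `{a ∘ b : a ∈ A, b ∈ [T]}` has nonempty interior in `2^ω`. -/
theorem composition_image_of_positive_and_laver_has_interior
    (μ : Measure (ℕ → Bool)) (hμ : IsFairCoinMeasure μ)
    (A : Set (ℕ → Bool)) (hA : MeasurableSet A) (hApos : 0 < μ A)
    (T : Set (List ℕ)) (hT : IsLaverTree T) :
    (interior {c : ℕ → Bool | ∃ a ∈ A, ∃ b ∈ branches T,
      c = fun n => a (b n)}).Nonempty := by
  obtain ⟨hTree, s, hs, -, hsplit⟩ := hT
  have : IsProbabilityMeasure μ := hμ.1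
  obtain ⟨K, hKA, hK, hKpos⟩ := hA.exists_lt_isClosed_of_ne_top (measure_ne_top μ A) hApos
  let f : (ℕ → Bool) → Fin s.length → Bool := fun a i => a s[i]
  let r : (ℕ → Bool) → Fin s.length → Bool := fun c i => c i
  have hf : Continuous f := continuous_pi fun i => continuous_apply _
  have hr : Continuous r := continuous_pi fun i => continuous_apply _
  obtain ⟨σ, hσ⟩ : ∃ σ, 0 < μ (K ∩ f ⁻¹' {σ}) := by
    by_contra! h
    refine hKpos.ne' (measure_mono_null (fun x hx => ?_)
      (measure_iUnion_null fun σ => le_antisymm (h σ) zero_le))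
    exact mem_iUnion.2 ⟨f x, hx, rfl⟩
  refine ⟨fun i => if h : i < s.length then σ ⟨i, h⟩ else false,
    mem_interior.2 ⟨r ⁻¹' {σ}, fun c hc => ?_, (isOpen_discrete _).preimage hr, ?_⟩⟩
  · obtain ⟨a, ha, b, hb, hab⟩ := hμ.exists_eq_comp_branch hTree hs hsplit
      (hK.inter ((isClosed_singleton (x := σ)).preimage hf)) hσ (c := c) (by
        rintro a ⟨-, ha⟩ i m him
        obtain ⟨hi, rfl⟩ := List.getElem?_eq_some_iff.1 him
        exact (congrFun ha ⟨i, hi⟩).trans (congrFun hc ⟨i, hi⟩).symm)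
    exact ⟨a, hKA ha.1, b, hb, hab⟩
  · ext i
    simp [r]
end

section
/- There exists a Borel set D ⊆ 2^ω × ω^ω such that for every Borel set A ⊆ 2^ω with μ(A) > 0 and every Laver tree T on ℕ, the rectangle A × [T] meets both D and its complement. In particular, the rectangular Ramsey property MRR(null ideal on 2^ω, Laver ideal) fails. -/
open MeasureTheory

/-- The set of sequences taking prescribed values on a finite set of coordinates. -/
def finsetCylinder (S : Finset ℕ) (f : ℕ → Bool) : Set (ℕ → Bool) :=
  {x | ∀ i ∈ S, x i = f i}

/-- The set of sequences vanishing on the `n` coordinates starting at `k`. -/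
def zeroBlock (n k : ℕ) : Set (ℕ → Bool) :=
  {x | ∀ i ∈ Finset.Ico k (k + n), x i = false}

lemma measurableSet_finsetCylinder (S : Finset ℕ) (f : ℕ → Bool) :
    MeasurableSet (finsetCylinder S f) := by
  have : finsetCylinder S f = ⋂ i ∈ S, (fun x : ℕ → Bool => x i) ⁻¹' {f i} := by
    ext x; simp [finsetCylinder]
  rw [this]
  exact Finset.measurableSet_biInter _ fun i _ =>
    measurable_pi_apply i (measurableSet_singleton _)

lemma zeroBlock_eq_finsetCylinder (n k : ℕ) :
    zeroBlock n k = finsetCylinder (Finset.Ico k (k + n)) fun _ => false := rfl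

lemma measurableSet_zeroBlock (n k : ℕ) : MeasurableSet (zeroBlock n k) :=
  measurableSet_finsetCylinder _ _

lemma isPiSystem_finsetCylinder :
    IsPiSystem {C | ∃ S f, C = finsetCylinder S f} := by
  rintro _ ⟨S, f, rfl⟩ _ ⟨S', f', rfl⟩ ⟨z, hz, hz'⟩
  refine ⟨S ∪ S', z, ?_⟩
  ext x
  constructor
  · rintro ⟨hx, hx'⟩ i hi
    rcases Finset.mem_union.1 hi with hi | hi
    · rw [hx i hi, hz i hi]
    · rw [hx' i hi, hz' i hi]
  · intro hx
    exact ⟨fun i hi => (hx i (Finset.mem_union_left _ hi)).trans (hz i hi),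
      fun i hi => (hx i (Finset.mem_union_right _ hi)).trans (hz' i hi)⟩

lemma generateFrom_finsetCylinder :
    (MeasurableSpace.pi : MeasurableSpace (ℕ → Bool)) =
      MeasurableSpace.generateFrom {C | ∃ S f, C = finsetCylinder S f} := by
  apply le_antisymm
  · refine iSup_le fun i => ?_
    rw [← measurable_iff_comap_le]
    refine @measurable_to_bool _ (_) _ ?_
    refine MeasurableSpace.measurableSet_generateFrom ⟨{i}, fun _ => true, ?_⟩
    ext x; simp [finsetCylinder]
  · refine MeasurableSpace.generateFrom_le ?_
    rintro _ ⟨S, f, rfl⟩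
    exact measurableSet_finsetCylinder S f

lemma IsFairCoinMeasure.measureReal_finsetCylinder {μ : Measure (ℕ → Bool)}
    (hμ : IsFairCoinMeasure μ) (S : Finset ℕ) (f : ℕ → Bool) :
    μ.real (finsetCylinder S f) = (1 / 2 : ℝ) ^ S.card := by
  have := hμ.1
  obtain ⟨N, hN⟩ : ∃ N, S ⊆ Finset.range N := S.exists_nat_subset_range
  obtain ⟨d, hd⟩ : ∃ d, (Finset.range N \ S).card = d := ⟨_, rfl⟩
  induction d generalizing S f with
  | zero =>
    have hS : S = Finset.range N := by
      apply hN.antisymm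
      rwa [← Finset.sdiff_eq_empty_iff_subset, ← Finset.card_eq_zero]
    subst hS
    have h := hμ.2 N f
    simp only [finsetCylinder, Finset.mem_range, Measure.real, h, Finset.card_range]
    simp
  | succ d ih =>
    obtain ⟨j, hj⟩ : (Finset.range N \ S).Nonempty := by
      rw [← Finset.card_pos]; omega
    obtain ⟨hjN, hjS⟩ := Finset.mem_sdiff.1 hj
    have key : ∀ b : Bool, μ.real (finsetCylinder (insert j S) (Function.update f j b)) =
        (1 / 2 : ℝ) ^ (S.card + 1) := by
      intro b
      rw [ih, Finset.card_insert_of_notMem hjS]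
      · exact Finset.insert_subset hjN hN
      · rw [Finset.sdiff_insert, Finset.card_erase_of_mem hj, hd]; rfl
    have mem : ∀ b x, x ∈ finsetCylinder (insert j S) (Function.update f j b) ↔
        x j = b ∧ x ∈ finsetCylinder S f := by
      intro b x
      simp only [finsetCylinder, Set.mem_ofPred_eq, Finset.forall_mem_insert,
        Function.update_self]
      refine and_congr_right fun _ => forall₂_congr fun i hi => ?_
      rw [Function.update_of_ne (by rintro rfl; exact hjS hi)]
    have hU : finsetCylinder S f =
        finsetCylinder (insert j S) (Function.update f j true) ∪
          finsetCylinder (insert j S) (Function.update f j false) := by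
      ext x
      rw [Set.mem_union, mem, mem]
      cases x j <;> simp
    rw [hU, measureReal_union _ (measurableSet_finsetCylinder _ _), key, key]
    · ring
    · rw [Set.disjoint_left]
      intro x hx hx'
      rw [mem] at hx hx'
      simp [hx.1] at hx'

lemma hasSum_measureReal_iUnion {α : Type*} [MeasurableSpace α] {μ : Measure α}
    [IsFiniteMeasure μ] {B : ℕ → Set α} (hd : Pairwise (Function.onFun Disjoint B))
    (hB : ∀ i, MeasurableSet (B i)) :
    HasSum (fun i => μ.real (B i)) (μ.real (⋃ i, B i)) := by
  have h : ∑' i, μ (B i) ≠ ⊤ := by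
    rw [← measure_iUnion hd hB]
    exact measure_ne_top _ _
  rw [Measure.real, measure_iUnion hd hB, ENNReal.tsum_toReal_eq fun i => measure_ne_top _ _]
  exact ENNReal.hasSum_toReal h

lemma IsFairCoinMeasure.measureReal_zeroBlock {μ : Measure (ℕ → Bool)}
    (hμ : IsFairCoinMeasure μ) (n k : ℕ) : μ.real (zeroBlock n k) = (1 / 2 : ℝ) ^ n := by
  rw [zeroBlock_eq_finsetCylinder, hμ.measureReal_finsetCylinder]
  simp

/-- The blocks `zeroBlock n k` become independent of any fixed measurable set as `k → ∞`. -/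
lemma IsFairCoinMeasure.tendsto_measureReal_inter_zeroBlock {μ : Measure (ℕ → Bool)}
    (hμ : IsFairCoinMeasure μ) (n : ℕ) {A : Set (ℕ → Bool)} (hA : MeasurableSet A) :
    Filter.Tendsto (fun k => μ.real (A ∩ zeroBlock n k)) Filter.atTop
      (nhds (μ.real A * (1 / 2 : ℝ) ^ n)) := by
  have := hμ.1
  induction A, hA using MeasurableSpace.induction_on_inter
    generateFrom_finsetCylinder isPiSystem_finsetCylinder with
  | empty => simp
  | basic C hC =>
    obtain ⟨S, f, rfl⟩ := hC
    obtain ⟨N, hN⟩ : ∃ N, S ⊆ Finset.range N := S.exists_nat_subset_range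
    refine tendsto_const_nhds.congr' ?_
    filter_upwards [Filter.eventually_ge_atTop N] with k hk
    have hdisj : Disjoint S (Finset.Ico k (k + n)) := by
      rw [Finset.disjoint_left]
      intro i hi hi'
      have := Finset.mem_range.1 (hN hi)
      have := (Finset.mem_Ico.1 hi').1
      omega
    have : finsetCylinder S f ∩ zeroBlock n k =
        finsetCylinder (S ∪ Finset.Ico k (k + n)) (fun i => if i ∈ S then f i else false) := by
      ext x
      simp only [finsetCylinder, zeroBlock, Set.mem_inter_iff, Set.mem_ofPred_eq,
        Finset.forall_mem_union]
      refine and_congr (forall₂_congr fun i hi => by rw [if_pos hi])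
        (forall₂_congr fun i hi => by rw [if_neg (Finset.disjoint_right.1 hdisj hi)])
    rw [this, hμ.measureReal_finsetCylinder, hμ.measureReal_finsetCylinder,
      Finset.card_union_of_disjoint hdisj, pow_add]
    simp
  | compl B hB ih =>
    have h : ∀ k, μ.real (Bᶜ ∩ zeroBlock n k) =
        (1 / 2 : ℝ) ^ n - μ.real (B ∩ zeroBlock n k) := by
      intro k
      rw [← hμ.measureReal_zeroBlock n k, ← measureReal_inter_add_sdiff (s := zeroBlock n k) hB,
        Set.inter_comm B, Set.inter_comm Bᶜ, Set.sdiff_eq]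
      ring
    simp only [h]
    rw [probReal_compl_eq_one_sub hB, sub_mul, one_mul]
    exact tendsto_const_nhds.sub ih
  | iUnion B hd hB ih =>
    have hsum : HasSum (fun i => μ.real (B i)) (μ.real (⋃ i, B i)) :=
      hasSum_measureReal_iUnion hd hB
    have h : ∀ k, μ.real ((⋃ i, B i) ∩ zeroBlock n k) =
        ∑' i, μ.real (B i ∩ zeroBlock n k) := by
      intro k
      rw [Set.iUnion_inter]
      refine (hasSum_measureReal_iUnion (fun i j hij => ?_) fun i => ?_).tsum_eq.symm
      · exact (hd hij).mono Set.inter_subset_left Set.inter_subset_left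
      · exact (hB i).inter (measurableSet_zeroBlock n k)
    simp only [h]
    rw [← hsum.tsum_eq, ← tsum_mul_right]
    refine tendsto_tsum_of_dominated_convergence hsum.summable ih ?_
    refine Filter.Eventually.of_forall fun k i => ?_
    rw [Real.norm_of_nonneg measureReal_nonneg]
    exact measureReal_mono Set.inter_subset_left

/-- In a tree splitting infinitely above `s`, every node `t` above `s` lies on a branch avoiding,
at each level beyond `t`, any prescribed finite set of values. -/
lemma exists_branch_of_eventually {T : Set (List ℕ)} (hT : IsTreeOnNat T) {s : List ℕ}
    (hs : ∀ t ∈ T, s <+: t → {m : ℕ | t ++ [m] ∈ T}.Infinite) {t : List ℕ} (ht : t ∈ T)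
    (hst : s <+: t) {Q : ℕ → ℕ → Prop} (hQ : ∀ n, ∀ᶠ m in Filter.atTop, Q n m) :
    ∃ y ∈ branches T, (List.ofFn fun i : Fin t.length => y i) = t ∧
      ∀ n, t.length ≤ n → Q n (y n) := by
  have hstep : ∀ u : List ℕ, ∃ m, u ∈ T → s <+: u → u ++ [m] ∈ T ∧ Q u.length m := by
    intro u
    by_cases hu : u ∈ T ∧ s <+: u
    · obtain ⟨m, hm, hm'⟩ :=
        ((Nat.frequently_atTop_iff_infinite.2 (hs u hu.1 hu.2)).and_eventually
          (hQ u.length)).exists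
      exact ⟨m, fun _ _ => ⟨hm, hm'⟩⟩
    · exact ⟨0, fun h h' => absurd ⟨h, h'⟩ hu⟩
  choose f hf using hstep
  let next : ℕ → List ℕ → ℕ := fun n u => if h : n < t.length then t[n] else f u
  let L : ℕ → List ℕ := fun n => Nat.rec [] (fun n u => u ++ [next n u]) n
  have hL : ∀ n, L (n + 1) = L n ++ [next n (L n)] := fun n => rfl
  have hlen : ∀ n, (L n).length = n := by
    intro n
    induction n with
    | zero => rfl
    | succ n ih => rw [hL, List.length_append, ih]; rfl
  have hfn : ∀ n, (List.ofFn fun i : Fin n => next i (L i)) = L n := by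
    intro n
    induction n with
    | zero => rfl
    | succ n ih => 
      rw [List.ofFn_succ', hL, List.concat_eq_append]
      simp only [Fin.val_castSucc, Fin.val_last, ih]
  have htake : ∀ n, n ≤ t.length → L n = t.take n := by
    intro n
    induction n with
    | zero => intro _; rfl
    | succ n ih =>
      intro hn
      rw [hL, ih (by omega), List.take_succ_eq_append_getElem (by omega)]
      simp only [next]
      rw [dif_pos (by omega)]
  have hbig : ∀ n, t.length ≤ n → L n ∈ T ∧ s <+: L n := by
    intro n hn
    induction n, hn using Nat.le_induction with
    | base => rw [htake _ le_rfl, List.take_length]; exact ⟨ht, hst⟩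
    | succ n hn ih =>
      rw [hL]
      simp only [next]
      rw [dif_neg (by omega)]
      exact ⟨(hf _ ih.1 ih.2).1, ih.2.trans (List.prefix_append _ _)⟩
  refine ⟨fun n => next n (L n), fun n => ?_, ?_, fun n hn => ?_⟩
  · rw [hfn]
    rcases le_total n t.length with h | h
    · rw [htake n h]
      exact hT t ht _ (List.take_prefix _ _)
    · exact (hbig n h).1
  · rw [hfn, htake _ le_rfl, List.take_length]
  · have := (hf _ (hbig n hn).1 (hbig n hn).2).2
    rw [hlen] at this
    simp only [next]
    rwa [dif_neg (by omega)]

/-- The pairs `(x, y)` for which `n` is the last index with `x ∈ zeroBlock n (y n)`. -/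
def lastZeroBlock (n : ℕ) : Set ((ℕ → Bool) × (ℕ → ℕ)) :=
  {p | p.1 ∈ zeroBlock n (p.2 n) ∧ ∀ m, n < m → p.1 ∉ zeroBlock m (p.2 m)}

lemma measurableSet_lastZeroBlock (n : ℕ) : MeasurableSet (lastZeroBlock n) := by
  have h : ∀ m, MeasurableSet
      {p : (ℕ → Bool) × (ℕ → ℕ) | p.1 ∈ zeroBlock m (p.2 m)} := by
    intro m
    have : {p : (ℕ → Bool) × (ℕ → ℕ) | p.1 ∈ zeroBlock m (p.2 m)} =
        ⋃ k, zeroBlock m k ×ˢ ((fun y : ℕ → ℕ => y m) ⁻¹' {k}) := by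
      ext p; simp
    rw [this]
    exact MeasurableSet.iUnion fun k => (measurableSet_zeroBlock m k).prod
      (measurable_pi_apply m (measurableSet_singleton k))
  have hset : lastZeroBlock n = {p | p.1 ∈ zeroBlock n (p.2 n)} ∩
      ⋂ m, ⋂ _ : n < m, {p | p.1 ∈ zeroBlock m (p.2 m)}ᶜ := by
    ext p; simp [lastZeroBlock]
  rw [hset]
  exact (h n).inter (MeasurableSet.iInter fun m => MeasurableSet.iInter fun _ => (h m).compl)

lemma lastZeroBlock_unique {n m : ℕ} {p : (ℕ → Bool) × (ℕ → ℕ)} (hn : p ∈ lastZeroBlock n)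
    (hm : p ∈ lastZeroBlock m) : n = m := by
  rcases lt_trichotomy n m with h | h | h
  · exact absurd hm.1 (hn.2 m h)
  · exact h
  · exact absurd hn.1 (hm.2 n h)

/-- Every rectangle with a positive-measure side and a Laver side meets `lastZeroBlock n` for all
sufficiently large `n`. -/
lemma IsFairCoinMeasure.eventually_inter_lastZeroBlock_nonempty {μ : Measure (ℕ → Bool)}
    (hμ : IsFairCoinMeasure μ) {A : Set (ℕ → Bool)} (hA : MeasurableSet A) (hpos : 0 < μ A)
    {T : Set (List ℕ)} (hT : IsLaverTree T) :
    ∀ᶠ n in Filter.atTop, ((A ×ˢ branches T) ∩ lastZeroBlock n).Nonempty := by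
  have := hμ.1
  obtain ⟨hT, s, hsT, -, hs⟩ := hT
  filter_upwards [Filter.eventually_ge_atTop (s.length + 2)] with n hn
  have eventually_pos : ∀ᶠ k in Filter.atTop, 0 < μ.real (A ∩ zeroBlock n k) := by
    refine (hμ.tendsto_measureReal_inter_zeroBlock n hA).eventually_const_lt ?_
    have : 0 < μ.real A := ENNReal.toReal_pos hpos.ne' (measure_ne_top _ _)
    positivity
  obtain ⟨y₀, hy₀, hy₀s, hy₀Q⟩ := exists_branch_of_eventually hT hs hsT List.prefix_rfl
    (Q := fun _ k => 0 < μ.real (A ∩ zeroBlock n k)) fun _ => eventually_pos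
  set B := A ∩ zeroBlock n (y₀ n) with hB
  have hBpos : 0 < μ.real B := hy₀Q n (by omega)
  have hBm : MeasurableSet B := hA.inter (measurableSet_zeroBlock _ _)
  set t := List.ofFn fun i : Fin (n + 1) => y₀ i with ht
  have htlen : t.length = n + 1 := by simp [ht]
  have hst : s <+: t := by
    rw [List.prefix_iff_eq_take]
    refine List.ext_getElem (by simp [htlen]; omega) fun i h₁ h₂ => ?_
    conv_lhs => rw [← List.getElem_of_eq hy₀s (by simpa using h₁)]
    simp [ht, -List.ofFn_succ]
  obtain ⟨y, hy, hyt, hyQ⟩ := exists_branch_of_eventually hT hs (hy₀ (n + 1)) hst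
    (Q := fun m k => μ.real (B ∩ zeroBlock m k) < μ.real B * (1 / 2 : ℝ) ^ m * 2) fun m => by
      refine (hμ.tendsto_measureReal_inter_zeroBlock m hBm).eventually_lt_const ?_
      have : 0 < μ.real B * (1 / 2 : ℝ) ^ m := by positivity
      linarith
  have hyn : y n = y₀ n := by
    have h := List.getElem_of_eq hyt (i := n) (by simp)
    simpa [ht, -List.ofFn_succ] using h
  have hex : ∃ x ∈ B, ∀ m, n < m → x ∉ zeroBlock m (y m) := by
    by_contra! hcon
    have hsub : B ⊆ ⋃ j, B ∩ zeroBlock (n + 1 + j) (y (n + 1 + j)) := by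
      intro x hx
      obtain ⟨m, hm, hxm⟩ := hcon x hx
      obtain ⟨j, rfl⟩ := Nat.exists_eq_add_of_le (Nat.succ_le_of_lt hm)
      exact Set.mem_iUnion.2 ⟨j, hx, hxm⟩
    have hgeo : HasSum (fun j => μ.real B * (1 / 2 : ℝ) ^ n * (1 / 2 : ℝ) ^ j)
        (μ.real B * (1 / 2 : ℝ) ^ n * 2) := hasSum_geometric_two.mul_left _
    have hle : μ B ≤ ENNReal.ofReal (μ.real B * (1 / 2 : ℝ) ^ n * 2) := by
      calc μ B ≤ ∑' j, μ (B ∩ zeroBlock (n + 1 + j) (y (n + 1 + j))) :=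
            (measure_mono hsub).trans (measure_iUnion_le _)
        _ ≤ ∑' j, ENNReal.ofReal (μ.real B * (1 / 2 : ℝ) ^ n * (1 / 2 : ℝ) ^ j) := by
            refine ENNReal.tsum_le_tsum fun j => ?_
            rw [← ofReal_measureReal]
            refine ENNReal.ofReal_le_ofReal ?_
            refine (hyQ (n + 1 + j) (by rw [htlen]; omega)).le.trans_eq ?_
            ring
        _ = _ := by
            rw [← hgeo.tsum_eq, ENNReal.ofReal_tsum_of_nonneg (fun j => by positivity)
              hgeo.summable]
    have hle' : μ.real B ≤ μ.real B * (1 / 2 : ℝ) ^ n * 2 :=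
      ENNReal.toReal_le_of_le_ofReal (by positivity) hle
    have hpow : (1 / 2 : ℝ) ^ n ≤ (1 / 2 : ℝ) ^ 2 :=
      pow_le_pow_of_le_one (by norm_num) (by norm_num) (by omega)
    nlinarith
  obtain ⟨x, hxB, hx⟩ := hex
  exact ⟨(x, y), ⟨hxB.1, hy⟩, by simpa only [hyn] using hxB.2, hx⟩

/-- There is a Borel set `D ⊆ 2^ω × ω^ω` meeting every rectangle `A × [T]`
(with `μ(A) > 0` and `T` a Laver tree) as well as its complement: the
rectangular Ramsey property `MRR(null, Laver)` fails. -/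
theorem mrr_null_laver_fails
    (μ : Measure (ℕ → Bool)) (hμ : IsFairCoinMeasure μ) :
    ∃ D : Set ((ℕ → Bool) × (ℕ → ℕ)), MeasurableSet D ∧
      ∀ (A : Set (ℕ → Bool)), MeasurableSet A → 0 < μ A →
        ∀ T : Set (List ℕ), IsLaverTree T →
          ((A ×ˢ branches T) ∩ D).Nonempty ∧
          ((A ×ˢ branches T) \ D).Nonempty := by
  refine ⟨⋃ n, lastZeroBlock (2 * n), MeasurableSet.iUnion fun n =>
    measurableSet_lastZeroBlock _, fun A hA hpos T hT => ?_⟩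
  obtain ⟨N, hN⟩ := Filter.eventually_atTop.1
    (hμ.eventually_inter_lastZeroBlock_nonempty hA hpos hT)
  constructor
  · obtain ⟨p, hp, hpD⟩ := hN (2 * N) (by omega)
    exact ⟨p, hp, Set.mem_iUnion.2 ⟨N, hpD⟩⟩
  · obtain ⟨p, hp, hpD⟩ := hN (2 * N + 1) (by omega)
    refine ⟨p, hp, fun h => ?_⟩
    obtain ⟨m, hm⟩ := Set.mem_iUnion.1 h
    have := lastZeroBlock_unique hpD hm
    omega
end

section
/- There exists a nonempty perfect set X ⊆ ω^ω consisting of mutually eventually different functions; that is, X is closed, has no isolated points, is nonempty, and for all distinct x, y ∈ X the set {n ∈ ℕ : x(n) = y(n)} is finite. -/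
/-- The function sending `n` to a code of the restriction of the binary sequence `b` to
`{0, …, n - 1}`. -/
def initialSegmentCode (b : ℕ → Bool) (n : ℕ) : ℕ :=
  Encodable.encode fun i : Fin n => b i

theorem initialSegmentCode_apply_eq_iff {b c : ℕ → Bool} {n : ℕ} :
    initialSegmentCode b n = initialSegmentCode c n ↔ ∀ i < n, b i = c i := by
  simp [initialSegmentCode, funext_iff, Fin.forall_iff]

theorem initialSegmentCode_injective : Function.Injective initialSegmentCode := fun _ _ h =>
  funext fun k =>
    initialSegmentCode_apply_eq_iff.1 (congrFun h (k + 1)) k k.lt_succ_self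

theorem continuous_initialSegmentCode : Continuous initialSegmentCode :=
  continuous_pi fun n =>
    (continuous_of_discreteTopology (f := fun s : Fin n → Bool => Encodable.encode s)).comp
      (continuous_pi fun i => continuous_apply (i : ℕ))

theorem finite_setOf_initialSegmentCode_eq {b c : ℕ → Bool} (h : b ≠ c) :
    {n | initialSegmentCode b n = initialSegmentCode c n}.Finite := by
  obtain ⟨k, hk⟩ := Function.ne_iff.1 h
  refine (Set.finite_Iic k).subset fun n hn => ?_
  by_contra hkn
  exact hk (initialSegmentCode_apply_eq_iff.1 hn k (not_le.1 hkn))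

theorem tendsto_update_not (b : ℕ → Bool) :
    Filter.Tendsto (fun n => Function.update b n (!b n)) Filter.atTop (nhds b) := by
  refine tendsto_pi_nhds.2 fun i => tendsto_const_nhds.congr' ?_
  filter_upwards [Filter.eventually_gt_atTop i] with n hn
  rw [Function.update_of_ne hn.ne]

theorem perfect_range_initialSegmentCode : Perfect (Set.range initialSegmentCode) where
  closed := (isCompact_range continuous_initialSegmentCode).isClosed
  acc := by
    rw [preperfect_iff_nhds]
    rintro _ ⟨b, rfl⟩ U hU
    obtain ⟨n, hn⟩ := ((continuous_initialSegmentCode.tendsto b).comp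
      (tendsto_update_not b) |>.eventually hU).exists
    refine ⟨_, ⟨hn, Set.mem_range_self _⟩, fun h => ?_⟩
    simpa using congrFun (initialSegmentCode_injective h) n

/-- There is a nonempty perfect subset of Baire space consisting of mutually
eventually different functions. -/
theorem exists_perfect_set_of_eventually_different_functions :
    ∃ X : Set (ℕ → ℕ), Perfect X ∧ X.Nonempty ∧
      ∀ x ∈ X, ∀ y ∈ X, x ≠ y → {n : ℕ | x n = y n}.Finite := by
  refine ⟨Set.range initialSegmentCode, perfect_range_initialSegmentCode,
    Set.range_nonempty _, ?_⟩
  rintro _ ⟨b, rfl⟩ _ ⟨c, rfl⟩ h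
  exact finite_setOf_initialSegmentCode_eq (ne_of_apply_ne _ h)
end
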